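/- arXiv:0906.3283 — 7 statements merged into one kernel-verified Lean document; each statement's English description precedes it below -/
import Mathlib

section
/- For any positive integers a_1, ..., a_n, b and any index 1 ≤ j < n, one has (b+1)/2 ≤ q_{n+1}(a_1,...,a_j, b, a_{j+1},...,a_n) / q_n(a_1,...,a_j, a_{j+1},...,a_n) ≤ b+1, where the numerator is the continuant of the word obtained by inserting the digit b after position j. -/
/-- The continuant of a finite word of partial quotients: `contL [a_1,…,a_n] = q_n(a_1,…,a_n)`,
where `q_{-1} = 0`, `q_0 = 1` and `q_n = a_n q_{n-1} + q_{n-2}`. -/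
def contL : List ℕ → ℕ
  | [] => 1
  | [a] => a
  | a :: b :: l => a * contL (b :: l) + contL l

theorem contL_le_contL_cons (a : ℕ) (ha : 1 ≤ a) (l : List ℕ) :
    contL l ≤ contL (a :: l) := by
  cases l with
  | nil => simpa [contL] using ha
  | cons b l =>
    simp only [contL]
    nlinarith [Nat.zero_le (contL (b :: l))]

theorem one_le_contL (l : List ℕ) (hl : ∀ a ∈ l, 1 ≤ a) : 1 ≤ contL l := by
  induction l with
  | nil => simp [contL]
  | cons a l ih =>
    exact (ih fun x hx => hl x (List.mem_cons_of_mem _ hx)).trans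
      (contL_le_contL_cons a (hl a List.mem_cons_self) l)

/-- Splitting a continuant after the prefix `l`: here `p` and `p'` are the continuants of `l` and
of `l` without its last digit. -/
theorem exists_contL_append_cons (l : List ℕ) (hl : ∀ a ∈ l, 1 ≤ a) :
    ∃ p p' : ℕ, p' ≤ p ∧
      ∀ x t, contL (l ++ x :: t) = p * contL (x :: t) + p' * contL t := by
  match l, hl with
  | [], _ => exact ⟨1, 0, by simp, by simp⟩
  | [a], hl => exact ⟨a, 1, hl a (by simp), by simp [contL]⟩
  | a :: c :: s, hl =>
    obtain ⟨p, p', hp, h⟩ := exists_contL_append_cons (c :: s)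
      fun x hx => hl x (List.mem_cons_of_mem _ hx)
    obtain ⟨r, r', hr, k⟩ := exists_contL_append_cons s
      fun x hx => hl x (List.mem_cons_of_mem _ (List.mem_cons_of_mem _ hx))
    refine ⟨a * p + r, a * p' + r', by gcongr, fun x t => ?_⟩
    have h' := h x t
    simp only [List.cons_append] at h' ⊢
    rw [contL, h', k]
    ring
termination_by l.length

/-- For positive integers `a_1,…,a_n, b` and any `1 ≤ j < n`, inserting the digit `b` after
position `j` changes the continuant by a factor between `(b+1)/2` and `b+1`.  Here the word is
written as `l₁ ++ l₂` with `l₁ = [a_1,…,a_j]` nonempty (so `j ≥ 1`) and `l₂ = [a_{j+1},…,a_n]`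
nonempty (so `j < n`). -/
theorem stmt1 (l₁ l₂ : List ℕ) (h₁ : l₁ ≠ []) (h₂ : l₂ ≠ [])
    (hpos : ∀ a ∈ l₁ ++ l₂, 1 ≤ a) (b : ℕ) (hb : 1 ≤ b) :
    ((b : ℝ) + 1) / 2 ≤ (contL (l₁ ++ b :: l₂) : ℝ) / (contL (l₁ ++ l₂) : ℝ) ∧
      (contL (l₁ ++ b :: l₂) : ℝ) / (contL (l₁ ++ l₂) : ℝ) ≤ (b : ℝ) + 1 := by
  have hK : (0 : ℝ) < contL (l₁ ++ l₂) := by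
    exact_mod_cast one_le_contL _ hpos
  obtain ⟨p, p', hp, h⟩ := exists_contL_append_cons l₁
    fun a ha => hpos a (List.mem_append_left _ ha)
  obtain ⟨c, t, rfl⟩ := List.exists_cons_of_ne_nil h₂
  have hq : contL t ≤ contL (c :: t) := contL_le_contL_cons c (hpos c (by simp)) t
  rw [div_le_div_iff₀ two_pos hK, div_le_iff₀ hK, h, h, contL]
  generalize contL (c :: t) = q at *
  generalize contL t = q' at *
  have hp0 : (0 : ℝ) ≤ p' := p'.cast_nonneg
  have hq0 : (0 : ℝ) ≤ q' := q'.cast_nonneg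
  have hb' : (1 : ℝ) ≤ b := by exact_mod_cast hb
  have hp' : (p' : ℝ) ≤ p := by exact_mod_cast hp
  have hq' : (q' : ℝ) ≤ q := by exact_mod_cast hq
  have hpq : (p' : ℝ) * q' ≤ p * q := mul_le_mul hp' hq' hq0 (hp0.trans hp')
  push_cast
  constructor
  · nlinarith [mul_nonneg (sub_nonneg.2 hb') (sub_nonneg.2 hpq),
      mul_nonneg hp0 (sub_nonneg.2 hq'), mul_nonneg hq0 (sub_nonneg.2 hp')]
  · nlinarith [mul_nonneg (sub_nonneg.2 hp') (sub_nonneg.2 hq'),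
      mul_nonneg (zero_le_one.trans hb') (mul_nonneg hp0 hq0)]
end

section
/- For any positive integers x_1, ..., x_n, any digit j ∈ ℕ and any position 1 ≤ i ≤ n, inserting j into the word at position i multiplies the length of the basic interval by at most 8/(j+1)²; that is, |I(x_1,...,x_{i−1}, j, x_i,...,x_n)| ≤ (8/(j+1)²) · |I(x_1,...,x_n)|. -/
open MeasureTheory

/-- The Gauss map `T(0) = 0`, `T(x) = 1/x mod 1`. -/
noncomputable def gaussMap (x : ℝ) : ℝ := if x = 0 then 0 else Int.fract (1 / x)

/-- The `n`-th partial quotient `a_n(x) = ⌊1 / T^{n-1}(x)⌋` of the regular continued fraction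
expansion of `x` (for `n ≥ 1`). -/
noncomputable def cfDigit (x : ℝ) (n : ℕ) : ℕ := ⌊1 / gaussMap^[n - 1] x⌋₊

/-- The basic interval determined by a finite word `w = (a_1,…,a_n)` of partial quotients:
`I(w) = {x ∈ [0,1) : a_i(x) = a_i, 1 ≤ i ≤ n}`. -/
def cylL (w : List ℕ) : Set ℝ :=
  {x | x ∈ Set.Ico (0 : ℝ) 1 ∧ ∀ i : Fin w.length, cfDigit x (i + 1) = w.get i}

/-- The continuant matrix of a word: the product of the matrices `!![0, 1; 1, a]`. Its bottom row
is `(q_{n-1}, q_n)` and its top row is `(p_{n-1}, p_n)`. -/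
noncomputable def cfMatrix (w : List ℕ) : Matrix (Fin 2) (Fin 2) ℝ :=
  (w.map fun a : ℕ => !![0, 1; 1, (a : ℝ)]).prod

theorem cfMatrix_append (u v : List ℕ) : cfMatrix (u ++ v) = cfMatrix u * cfMatrix v := by
  simp [cfMatrix]

theorem cfMatrix_cons (a : ℕ) (w : List ℕ) :
    cfMatrix (a :: w) = !![0, 1; 1, (a : ℝ)] * cfMatrix w := by
  simp [cfMatrix]

theorem abs_det_cfMatrix (w : List ℕ) : |(cfMatrix w).det| = 1 := by
  induction w with
  | nil => simp [cfMatrix]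
  | cons a w ih => rw [cfMatrix_cons, Matrix.det_mul, abs_mul, ih]; simp [Matrix.det_fin_two]

/-- Order relations between the entries of a continuant matrix. -/
structure IsContinuantLike (M : Matrix (Fin 2) (Fin 2) ℝ) : Prop where
  nonneg : ∀ i j, 0 ≤ M i j
  pos : 0 < M 1 1
  col_le : M 0 1 ≤ M 1 1
  row_le : M 1 0 ≤ M 1 1
  col_add_le : M 1 0 + M 0 0 ≤ M 1 1 + M 0 1
  row_add_le : M 0 0 + M 0 1 ≤ M 1 0 + M 1 1

theorem isContinuantLike_cfMatrix {w : List ℕ} (hw : ∀ a ∈ w, 1 ≤ a) :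
    IsContinuantLike (cfMatrix w) := by
  induction w with
  | nil =>
    refine ⟨fun i j => ?_, ?_, ?_, ?_, ?_, ?_⟩
    · fin_cases i <;> fin_cases j <;> simp [cfMatrix]
    all_goals simp [cfMatrix]
  | cons a w ih =>
    obtain ⟨h0, hp, h1, h2, h3, h4⟩ := ih fun b hb => hw b (List.mem_cons_of_mem _ hb)
    have ha : (1 : ℝ) ≤ a := by exact_mod_cast hw a List.mem_cons_self
    have h00 := h0 0 0
    have h01 := h0 0 1
    have h10 := h0 1 0
    rw [cfMatrix_cons]
    refine ⟨fun i j => ?_, ?_, ?_, ?_, ?_, ?_⟩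
    · fin_cases i <;> fin_cases j <;> simp [Matrix.mul_apply, Fin.sum_univ_two] <;> positivity
    all_goals simp [Matrix.mul_apply, Fin.sum_univ_two]
    · positivity
    all_goals nlinarith

theorem mem_cylL_cons {a : ℕ} (ha : 1 ≤ a) (w : List ℕ) (x : ℝ) :
    x ∈ cylL (a :: w) ↔ (0 < x ∧ x < 1) ∧ ⌊1 / x⌋₊ = a ∧ 1 / x - a ∈ cylL w := by
  have key (h0 : 0 < x) (hf : ⌊1 / x⌋₊ = a) : gaussMap x = 1 / x - a := by
    rw [gaussMap, if_neg h0.ne', Int.fract, ← hf, natCast_floor_eq_intCast_floor (by positivity)]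
  have digit (n : ℕ) : cfDigit x (n + 1 + 1) = cfDigit (gaussMap x) (n + 1) := by
    simp [cfDigit, Function.iterate_succ_apply]
  constructor
  · rintro ⟨⟨h0, h1⟩, hd⟩
    have hf : ⌊1 / x⌋₊ = a := by simpa [cfDigit] using hd ⟨0, by simp⟩
    have hx : 0 < x := by
      rcases h0.eq_or_lt with rfl | h
      · simp at hf; omega
      · exact h
    refine ⟨⟨hx, h1⟩, hf, ?_, fun i => ?_⟩
    · rw [← key hx hf, gaussMap, if_neg hx.ne']
      exact ⟨Int.fract_nonneg _, Int.fract_lt_one _⟩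
    · rw [← key hx hf, ← digit]
      simpa using hd i.succ
  · rintro ⟨⟨h0, h1⟩, hf, -, hd⟩
    refine ⟨⟨h0.le, h1⟩, fun i => ?_⟩
    refine Fin.cases ?_ (fun i => ?_) i
    · simpa [cfDigit] using hf
    · rw [← key h0 hf] at hd
      simpa [digit] using hd i

theorem one_div_sub_mem_uIcc {c u v x : ℝ} (hc : 0 < c) (hu : 0 ≤ u) (hv : 0 ≤ v) (hx : 0 < x) :
    1 / x - c ∈ Set.uIcc u v ↔ x ∈ Set.uIcc (1 / (c + u)) (1 / (c + v)) := by
  have hu' : 0 < c + u := by positivity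
  have hv' : 0 < c + v := by positivity
  simp only [Set.mem_uIcc, le_sub_iff_add_le', sub_le_iff_le_add', div_le_iff₀ hu',
    div_le_iff₀ hv', le_div_iff₀ hu', le_div_iff₀ hv', div_le_iff₀ hx, le_div_iff₀ hx,
    mul_comm x]
  tauto

theorem one_div_sub_mem_uIoo {c u v x : ℝ} (hc : 0 < c) (hu : 0 ≤ u) (hv : 0 ≤ v) (hx : 0 < x) :
    1 / x - c ∈ Set.uIoo u v ↔ x ∈ Set.uIoo (1 / (c + u)) (1 / (c + v)) := by
  have hu' : 0 < c + u := by positivity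
  have hv' : 0 < c + v := by positivity
  have mem (y a b : ℝ) : y ∈ Set.uIoo a b ↔ a < y ∧ y < b ∨ b < y ∧ y < a := by
    rcases le_total a b with h | h
    · rw [Set.uIoo_of_le h]
      exact ⟨Or.inl, fun h' => h'.elim id fun h' => by constructor <;> linarith⟩
    · rw [Set.uIoo_of_ge h]
      exact ⟨Or.inr, fun h' => h'.elim (fun h' => by constructor <;> linarith) id⟩
  simp only [mem, lt_sub_iff_add_lt', sub_lt_iff_lt_add', div_lt_iff₀ hu',
    div_lt_iff₀ hv', lt_div_iff₀ hu', lt_div_iff₀ hv', div_lt_iff₀ hx, lt_div_iff₀ hx,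
    mul_comm x]
  tauto

/-- The two endpoints `p_n / q_n` and `(p_{n-1} + p_n) / (q_{n-1} + q_n)` of a basic interval. -/
theorem cylL_between {w : List ℕ} (hw : ∀ a ∈ w, 1 ≤ a) :
    Set.uIoo (cfMatrix w 0 1 / cfMatrix w 1 1)
        ((cfMatrix w 0 0 + cfMatrix w 0 1) / (cfMatrix w 1 0 + cfMatrix w 1 1)) ⊆ cylL w ∧
      cylL w ⊆ Set.uIcc (cfMatrix w 0 1 / cfMatrix w 1 1)
        ((cfMatrix w 0 0 + cfMatrix w 0 1) / (cfMatrix w 1 0 + cfMatrix w 1 1)) := by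
  induction w with
  | nil =>
    constructor
    · intro x hx
      simp [cfMatrix] at hx
      exact ⟨⟨hx.1.le, hx.2⟩, fun i => i.elim0⟩
    · intro x hx
      simpa [cfMatrix] using ⟨hx.1.1, hx.1.2.le⟩
  | cons a w ih =>
    have hw' : ∀ b ∈ w, 1 ≤ b := fun b hb => hw b (List.mem_cons_of_mem _ hb)
    have ha := hw a List.mem_cons_self
    have ha' : (1 : ℝ) ≤ a := by exact_mod_cast ha
    have hc : (0 : ℝ) < a := by linarith
    obtain ⟨ih1, ih2⟩ := ih hw'
    obtain ⟨h0, hp, h1, -, -, h4⟩ := isContinuantLike_cfMatrix hw'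
    have h00 := h0 0 0
    have h01 := h0 0 1
    have h10 := h0 1 0
    have hq : 0 < cfMatrix w 1 0 + cfMatrix w 1 1 := by positivity
    have e1 : cfMatrix (a :: w) 0 1 / cfMatrix (a :: w) 1 1 =
        1 / (a + cfMatrix w 0 1 / cfMatrix w 1 1) := by
      simp only [cfMatrix_cons, Matrix.mul_apply, Fin.sum_univ_two]
      simp
      field_simp
      ring
    have e2 : (cfMatrix (a :: w) 0 0 + cfMatrix (a :: w) 0 1) /
          (cfMatrix (a :: w) 1 0 + cfMatrix (a :: w) 1 1) =
        1 / (a + (cfMatrix w 0 0 + cfMatrix w 0 1) / (cfMatrix w 1 0 + cfMatrix w 1 1)) := by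
      simp only [cfMatrix_cons, Matrix.mul_apply, Fin.sum_univ_two]
      simp
      field_simp
      ring
    rw [e1, e2]
    have hu1 := (div_le_one hp).2 h1
    have hv1 := (div_le_one hq).2 h4
    have hu : 0 ≤ cfMatrix w 0 1 / cfMatrix w 1 1 := by positivity
    have hv : 0 ≤ (cfMatrix w 0 0 + cfMatrix w 0 1) / (cfMatrix w 1 0 + cfMatrix w 1 1) := by
      positivity
    generalize cfMatrix w 0 1 / cfMatrix w 1 1 = u at *
    generalize (cfMatrix w 0 0 + cfMatrix w 0 1) / (cfMatrix w 1 0 + cfMatrix w 1 1) = v at *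
    constructor
    · intro x hx
      have hx0 : 0 < x := lt_of_le_of_lt (le_min (by positivity) (by positivity)) hx.1
      have ht := (one_div_sub_mem_uIoo hc hu hv hx0).2 hx
      have t0 : 0 < 1 / x - a := lt_of_le_of_lt (le_min hu hv) ht.1
      have t1 : 1 / x - a < 1 := lt_of_lt_of_le ht.2 (max_le hu1 hv1)
      refine (mem_cylL_cons ha w x).2 ⟨⟨hx0, ?_⟩, ?_, ih1 ht⟩
      · have : 1 < 1 / x := by linarith
        rwa [lt_div_iff₀ hx0, one_mul] at this
      · rw [Nat.floor_eq_iff (by positivity)]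
        constructor <;> linarith
    · intro x hx
      obtain ⟨⟨hx0, -⟩, -, ht⟩ := (mem_cylL_cons ha w x).1 hx
      exact (one_div_sub_mem_uIcc hc hu hv hx0).1 (ih2 ht)

/-- The length of a basic interval is `1 / (q_n (q_{n-1} + q_n))`. -/
theorem volume_cylL {w : List ℕ} (hw : ∀ a ∈ w, 1 ≤ a) :
    volume (cylL w) = ENNReal.ofReal
      (1 / (cfMatrix w 1 1 * (cfMatrix w 1 0 + cfMatrix w 1 1))) := by
  obtain ⟨h1, h2⟩ := cylL_between hw
  obtain ⟨h0, hp, -⟩ := isContinuantLike_cfMatrix hw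
  have h10 := h0 1 0
  have hq : 0 < cfMatrix w 1 0 + cfMatrix w 1 1 := by positivity
  have e : |(cfMatrix w 0 0 + cfMatrix w 0 1) / (cfMatrix w 1 0 + cfMatrix w 1 1) -
      cfMatrix w 0 1 / cfMatrix w 1 1| =
      1 / (cfMatrix w 1 1 * (cfMatrix w 1 0 + cfMatrix w 1 1)) := by
    have hd := abs_det_cfMatrix w
    rw [Matrix.det_fin_two] at hd
    rw [div_sub_div _ _ hq.ne' hp.ne', abs_div, abs_of_pos (mul_pos hq hp),
      mul_comm (cfMatrix w 1 1), ← hd]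
    congr 2
    ring
  rw [← e]
  refine le_antisymm ((measure_mono h2).trans_eq Real.volume_interval) ?_
  exact Real.volume_uIoo.symm.trans_le (measure_mono h1)

/-- Inserting a digit `j` into a word multiplies the continuant by at least `(j + 1) / 2`. -/
theorem continuant_insert_ge {u v : List ℕ} (hu : ∀ a ∈ u, 1 ≤ a) (hv : ∀ a ∈ v, 1 ≤ a)
    {j : ℕ} (hj : 1 ≤ j) :
    ((j : ℝ) + 1) / 2 * cfMatrix (u ++ v) 1 1 ≤ cfMatrix (u ++ j :: v) 1 1 := by
  obtain ⟨a0, ap, -, a2, -⟩ := isContinuantLike_cfMatrix hu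
  obtain ⟨b0, bp, b1, -⟩ := isContinuantLike_cfMatrix hv
  have hj' : (1 : ℝ) ≤ j := by exact_mod_cast hj
  have a10 := a0 1 0
  have b01 := b0 0 1
  rw [cfMatrix_append, cfMatrix_append, cfMatrix_cons]
  simp only [Matrix.mul_apply, Fin.sum_univ_two]
  simp
  have k1 : cfMatrix u 1 0 * cfMatrix v 0 1 ≤ cfMatrix u 1 1 * cfMatrix v 1 1 :=
    mul_le_mul a2 b1 b01 ap.le
  have k2 := mul_nonneg (sub_nonneg.2 hj') (sub_nonneg.2 k1)
  have k3 := mul_nonneg a10 (sub_nonneg.2 b1)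
  have k4 := mul_nonneg ap.le b01
  nlinarith

/-- Inserting a digit `j ≥ 1` at position `i` (with `1 ≤ i ≤ n`, i.e. after a prefix `w₁` of
length `i - 1` and before a nonempty suffix `w₂`) multiplies the length of the basic interval
by at most `8/(j+1)²`. -/
theorem stmt4 (w₁ w₂ : List ℕ) (hpos : ∀ a ∈ w₁ ++ w₂, 1 ≤ a) (hw₂ : w₂ ≠ [])
    (j : ℕ) (hj : 1 ≤ j) :
    volume (cylL (w₁ ++ j :: w₂)) ≤
      ENNReal.ofReal (8 / ((j : ℝ) + 1) ^ 2) * volume (cylL (w₁ ++ w₂)) := by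
  have h₁ : ∀ a ∈ w₁, 1 ≤ a := fun a ha => hpos a (List.mem_append_left _ ha)
  have h₂ : ∀ a ∈ w₂, 1 ≤ a := fun a ha => hpos a (List.mem_append_right _ ha)
  have hpos' : ∀ a ∈ w₁ ++ j :: w₂, 1 ≤ a := by
    intro a ha
    rcases List.mem_append.1 ha with h | h
    · exact h₁ a h
    · rcases List.mem_cons.1 h with rfl | h
      · exact hj
      · exact h₂ a h
  have hle := continuant_insert_ge h₁ h₂ hj
  obtain ⟨a0, ap, -, a2, -⟩ := isContinuantLike_cfMatrix hpos
  obtain ⟨b0, bp, -⟩ := isContinuantLike_cfMatrix hpos'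
  have a10 := a0 1 0
  have b10 := b0 1 0
  rw [volume_cylL hpos, volume_cylL hpos', ← ENNReal.ofReal_mul (by positivity)]
  refine ENNReal.ofReal_le_ofReal ?_
  generalize cfMatrix (w₁ ++ w₂) 1 1 = q at *
  generalize cfMatrix (w₁ ++ w₂) 1 0 = r at *
  generalize cfMatrix (w₁ ++ j :: w₂) 1 1 = q' at *
  generalize cfMatrix (w₁ ++ j :: w₂) 1 0 = r' at *
  rw [div_mul_div_comm, div_le_div_iff₀ (by positivity) (by positivity)]
  have hsq : (((j : ℝ) + 1) / 2 * q) ^ 2 ≤ q' ^ 2 := pow_le_pow_left₀ (by positivity) hle 2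
  have k1 : q * (r + q) ≤ 2 * q ^ 2 := by nlinarith
  have k2 := mul_le_mul_of_nonneg_left k1 (sq_nonneg ((j : ℝ) + 1))
  have k3 := mul_nonneg bp.le b10
  nlinarith
end

section
/- Fix N ≥ 1 and k ≥ 1. For every h > 0 and ε > 0 there exists n_0 such that for all n ≥ n_0, the number of words ω ∈ {1,...,N}^n with H_k(ω) ≤ kh is at most exp(n(h + ε)). -/
/-- `φ(0) = 0` and `φ(t) = -t log t` for `t ≠ 0`. -/
noncomputable def phiEnt (t : ℝ) : ℝ := if t = 0 then 0 else -t * Real.log t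

/-- `τ_u(ω)`, the number of `j` with `1 ≤ j ≤ n - k + 1` such that
`(ω_j, …, ω_{j+k-1}) = u` (here `j` is 0-indexed, running over `0 ≤ j ≤ n - k`). -/
noncomputable def tauW {N n k : ℕ} (ω : Fin n → Fin N) (u : Fin k → Fin N) : ℕ :=
  Set.ncard {j : ℕ | j + k ≤ n ∧ ∀ (i : Fin k) (h : j + i.val < n), ω ⟨j + i.val, h⟩ = u i}

/-- `H_k(ω) = ∑_{u ∈ {1,…,N}^k} φ(p(u|ω))` where `p(u|ω) = τ_u(ω)/(n-k+1)`. -/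
noncomputable def entH {N n : ℕ} (k : ℕ) (ω : Fin n → Fin N) : ℝ :=
  ∑ u : Fin k → Fin N, phiEnt ((tauW ω u : ℝ) / ((n : ℝ) - (k : ℝ) + 1))

/-- The word of length `k` read in `ω` from position `j` on. -/
def window {N n k : ℕ} (ω : Fin n → Fin N) (j : Fin (n + 1 - k)) : Fin k → Fin N :=
  fun i => ω ⟨j + i, by omega⟩

theorem tauW_eq_card {N n k : ℕ} (ω : Fin n → Fin N) (u : Fin k → Fin N) :
    tauW ω u = (Finset.univ.filter fun j => window ω j = u).card := by
  have hset : {j : ℕ | j + k ≤ n ∧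
      ∀ (i : Fin k) (h : j + i.val < n), ω ⟨j + i.val, h⟩ = u i} =
      ((Finset.univ.filter fun j => window ω j = u).map Fin.valEmbedding : Finset ℕ) := by
    ext j
    simp only [Set.mem_ofPred_eq, Finset.coe_map, Set.mem_image, Finset.mem_coe,
      Finset.mem_filter, Finset.mem_univ, true_and, Fin.valEmbedding_apply]
    constructor
    · rintro ⟨hj, h⟩
      exact ⟨⟨j, by omega⟩, funext fun i => h i (by omega), rfl⟩
    · rintro ⟨j, h, rfl⟩
      exact ⟨by omega, fun i _ => congrFun h i⟩
  rw [tauW, hset, Set.ncard_coe_finset, Finset.card_map]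

theorem sum_tauW {N n k : ℕ} (ω : Fin n → Fin N) :
    ∑ u : Fin k → Fin N, tauW ω u = n + 1 - k := by
  simp_rw [tauW_eq_card]
  rw [← Finset.card_eq_sum_card_fiberwise (fun _ _ => Finset.mem_coe.2 (Finset.mem_univ _))]
  simp

theorem phiEnt_eq (t : ℝ) : phiEnt t = -t * Real.log t := by
  unfold phiEnt
  split_ifs with h <;> simp [h]

/-- The likelihood of the windows of `ω` under their empirical distribution. -/
theorem prod_window_eq_exp {N n k : ℕ} (hkn : k ≤ n) (ω : Fin n → Fin N) :
    ∏ j, (tauW ω (window (k := k) ω j) : ℝ) / ((n + 1 - k : ℕ) : ℝ) =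
      Real.exp (-((n + 1 - k : ℕ) : ℝ) * entH k ω) := by
  have hL : (0 : ℝ) < ((n + 1 - k : ℕ) : ℝ) := by
    exact_mod_cast (by omega : 0 < n + 1 - k)
  have hcast : (n : ℝ) - k + 1 = ((n + 1 - k : ℕ) : ℝ) := by
    rw [Nat.cast_sub (by omega)]
    push_cast
    ring
  have hpos (j : Fin (n + 1 - k)) :
      0 < (tauW ω (window (k := k) ω j) : ℝ) / ((n + 1 - k : ℕ) : ℝ) := by
    refine div_pos ?_ hL
    rw [tauW_eq_card, Nat.cast_pos, Finset.card_pos]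
    exact ⟨j, by simp⟩
  rw [← Real.exp_log (Finset.prod_pos fun j _ => hpos j),
    Real.log_prod fun j _ => (hpos j).ne']
  congr 1
  rw [entH, hcast, Finset.mul_sum,
    ← Finset.sum_fiberwise_of_maps_to (s := Finset.univ) (t := Finset.univ)
      (g := window (k := k) ω) (fun _ _ => Finset.mem_univ _)]
  refine Finset.sum_congr rfl fun u _ => ?_
  rw [Finset.sum_congr rfl (g := fun _ => Real.log ((tauW ω u : ℝ) / ((n + 1 - k : ℕ) : ℝ)))
    fun j hj => by rw [(Finset.mem_filter.1 hj).2], Finset.sum_const, ← tauW_eq_card, phiEnt_eq,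
    nsmul_eq_mul]
  field_simp

/-- The disjoint windows starting at positions congruent to `r` modulo `k`, together with the
first and last `k` letters, determine a word, so the total mass of the words under
the associated product weights is bounded. -/
theorem sum_prod_window_le {N n k r : ℕ} (hr : r < k) (hkn : 2 * k ≤ n)
    (q : (Fin k → Fin N) → ℝ) (hq : ∀ u, 0 ≤ q u) (hq1 : ∑ u, q u ≤ 1) :
    ∑ ω : Fin n → Fin N, ∏ j : {j : Fin (n + 1 - k) // j.val % k = r}, q (window ω j.1) ≤
      (N : ℝ) ^ (2 * k) := by
  let f : (Fin n → Fin N) →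
      ({j : Fin (n + 1 - k) // j.val % k = r} → Fin k → Fin N) ×
        ((Fin k → Fin N) × (Fin k → Fin N)) :=
    fun ω => (fun j => window ω j.1,
      (fun i => ω ⟨i, by omega⟩, fun i => ω ⟨n - k + i, by omega⟩))
  have hf : Function.Injective f := by
    intro ω ω' h
    simp only [f, Prod.mk.injEq] at h
    obtain ⟨hmid, hfirst, hlast⟩ := h
    ext1 x
    obtain ⟨x, hx⟩ := x
    by_cases h1 : x < k
    · exact congrFun hfirst ⟨x, h1⟩
    by_cases h2 : n - k ≤ x
    · have := congrFun hlast ⟨x - (n - k), by omega⟩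
      simpa only [Nat.add_sub_cancel' h2] using this
    have hmod : (x - r) % k < k := Nat.mod_lt _ (by omega)
    have hdiv : k * ((x - r) / k) + (x - r) % k = x - r := Nat.div_add_mod _ _
    have hstart : (r + k * ((x - r) / k)) % k = r := by
      rw [Nat.add_mul_mod_self_left, Nat.mod_eq_of_lt hr]
    have := congrFun (congrFun hmid ⟨⟨r + k * ((x - r) / k), by omega⟩, hstart⟩)
      ⟨(x - r) % k, hmod⟩
    have hsum : r + k * ((x - r) / k) + (x - r) % k = x := by omega
    simpa only [window, hsum] using this
  calc
    _ = ∑ ω : Fin n → Fin N, ∏ j, q ((f ω).1 j) := rfl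
    _ = ∑ y ∈ Finset.univ.map ⟨f, hf⟩, ∏ j, q (y.1 j) := by simp
    _ ≤ ∑ y : ({j : Fin (n + 1 - k) // j.val % k = r} → Fin k → Fin N) ×
        ((Fin k → Fin N) × (Fin k → Fin N)), ∏ j, q (y.1 j) :=
      Finset.sum_le_sum_of_subset_of_nonneg (Finset.subset_univ _)
        fun _ _ _ => Finset.prod_nonneg fun _ _ => hq _
    _ = (N : ℝ) ^ (2 * k) *
        ∏ _j : {j : Fin (n + 1 - k) // j.val % k = r}, ∑ u, q u := by
      rw [Fintype.sum_prod_type, Finset.prod_univ_sum, Fintype.piFinset_univ, Finset.mul_sum]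
      refine Finset.sum_congr rfl fun b _ => ?_
      simp [two_mul, pow_add]
    _ ≤ (N : ℝ) ^ (2 * k) * 1 := by
      gcongr
      exact Finset.prod_le_one (fun _ _ => Finset.sum_nonneg fun u _ => hq u) fun _ _ => hq1
    _ = _ := mul_one _

/-- A word of small empirical entropy has large likelihood along some residue class. -/
theorem exp_le_sum_prod_window {N n k : ℕ} (hk : 1 ≤ k) (hkn : k ≤ n) {h : ℝ}
    (ω : Fin n → Fin N) (hω : entH k ω ≤ k * h) :
    Real.exp (-((n + 1 - k : ℕ) : ℝ) * h) ≤
      ∑ r ∈ Finset.range k, ∏ j : {j : Fin (n + 1 - k) // j.val % k = r},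
        (tauW ω (window (k := k) ω j.1) : ℝ) / ((n + 1 - k : ℕ) : ℝ) := by
  set F : Fin (n + 1 - k) → ℝ :=
    fun j => (tauW ω (window (k := k) ω j) : ℝ) / ((n + 1 - k : ℕ) : ℝ)
  have hF0 (j) : 0 ≤ F j := by positivity
  set P : ℕ → ℝ := fun r => ∏ j : {j : Fin (n + 1 - k) // j.val % k = r}, F j.1
  have hP0 (r) : 0 ≤ P r := Finset.prod_nonneg fun _ _ => hF0 _
  have hprod : ∏ r ∈ Finset.range k, P r = ∏ j, F j := by
    rw [← Finset.prod_fiberwise_of_maps_to (s := Finset.univ) (t := Finset.range k)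
      (g := fun j : Fin (n + 1 - k) => j.val % k)
      (fun _ _ => Finset.mem_range.2 (Nat.mod_lt _ hk))]
    refine Finset.prod_congr rfl fun r _ => ?_
    exact (Finset.prod_subtype _ (by simp) F).symm
  have hle : ∏ r ∈ Finset.range k, P r ≤ (∑ r ∈ Finset.range k, P r) ^ k := by
    calc _ ≤ ∏ _r ∈ Finset.range k, ∑ r ∈ Finset.range k, P r :=
          Finset.prod_le_prod (fun r _ => hP0 r)
            fun r hr => Finset.single_le_sum (fun r _ => hP0 r) hr
      _ = _ := by simp
  change _ ≤ ∑ r ∈ Finset.range k, P r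
  rw [← pow_le_pow_iff_left₀ (Real.exp_pos _).le (Finset.sum_nonneg fun r _ => hP0 r)
    (by omega : k ≠ 0)]
  refine le_trans ?_ hle
  rw [hprod, prod_window_eq_exp hkn, ← Real.exp_nat_mul, Real.exp_le_exp]
  have := mul_le_mul_of_nonneg_left hω (Nat.cast_nonneg (α := ℝ) (n + 1 - k))
  linarith

theorem ncard_entH_le {N n k : ℕ} (hk : 1 ≤ k) (hkn : 2 * k ≤ n) (h : ℝ) :
    (Set.ncard {ω : Fin n → Fin N | entH k ω ≤ (k : ℝ) * h} : ℝ) ≤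
      Real.exp (((n + 1 - k : ℕ) : ℝ) * h) *
        (((n + 1 - k + 1 : ℕ) : ℝ) ^ (N ^ k) * (k * (N : ℝ) ^ (2 * k))) := by
  classical
  set L := n + 1 - k with hL
  let q : ((Fin k → Fin N) → Fin (L + 1)) → (Fin k → Fin N) → ℝ :=
    fun t u => ((t u : ℕ) : ℝ) / ∑ v, ((t v : ℕ) : ℝ)
  have hq (t u) : 0 ≤ q t u := by positivity
  have hq1 (t) : ∑ u, q t u ≤ 1 := by
    rw [← Finset.sum_div]
    exact div_self_le_one _
  let G : ((Fin k → Fin N) → Fin (L + 1)) → (Fin n → Fin N) → ℝ := fun t ω =>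
    ∑ r ∈ Finset.range k, ∏ j : {j : Fin (n + 1 - k) // j.val % k = r}, q t (window ω j.1)
  have hG (t ω) : 0 ≤ G t ω :=
    Finset.sum_nonneg fun _ _ => Finset.prod_nonneg fun _ _ => hq _ _
  have hGsum (t) : ∑ ω, G t ω ≤ k * (N : ℝ) ^ (2 * k) := by
    rw [Finset.sum_comm]
    calc _ ≤ ∑ _r ∈ Finset.range k, (N : ℝ) ^ (2 * k) :=
          Finset.sum_le_sum fun r hr =>
            sum_prod_window_le (Finset.mem_range.1 hr) hkn (q t) (hq t) (hq1 t)
      _ = _ := by simp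
  have hmem (ω : Fin n → Fin N) (hω : entH k ω ≤ k * h) :
      1 ≤ Real.exp ((L : ℝ) * h) * ∑ t, G t ω := by
    let t : (Fin k → Fin N) → Fin (L + 1) := fun u => ⟨tauW ω u, by
      rw [Nat.lt_succ_iff, hL, ← sum_tauW ω]
      exact Finset.single_le_sum (f := tauW ω) (fun _ _ => Nat.zero_le _) (Finset.mem_univ u)⟩
    have ht (u) : q t u = (tauW ω u : ℝ) / (L : ℝ) := by
      simp only [q, t]
      rw [← Nat.cast_sum, sum_tauW]
    have h1 : Real.exp (-(L : ℝ) * h) ≤ G t ω := by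
      simp only [G, ht]
      exact exp_le_sum_prod_window hk (by omega) ω hω
    have h2 : G t ω ≤ ∑ t, G t ω :=
      Finset.single_le_sum (fun t _ => hG t ω) (Finset.mem_univ t)
    calc 1 = Real.exp ((L : ℝ) * h) * Real.exp (-(L : ℝ) * h) := by
          rw [← Real.exp_add]; simp
      _ ≤ _ := by gcongr; exact h1.trans h2
  rw [Set.ncard_eq_toFinset_card', Finset.cast_card]
  calc
    _ ≤ ∑ ω ∈ {ω : Fin n → Fin N | entH k ω ≤ (k : ℝ) * h}.toFinset,
        Real.exp ((L : ℝ) * h) * ∑ t, G t ω :=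
      Finset.sum_le_sum fun ω hω => hmem ω (by simpa using hω)
    _ ≤ ∑ ω, Real.exp ((L : ℝ) * h) * ∑ t, G t ω :=
      Finset.sum_le_sum_of_subset_of_nonneg (Finset.subset_univ _) fun ω _ _ =>
        mul_nonneg (Real.exp_pos _).le (Finset.sum_nonneg fun t _ => hG t ω)
    _ = Real.exp ((L : ℝ) * h) * ∑ t, ∑ ω, G t ω := by
      rw [← Finset.mul_sum, Finset.sum_comm]
    _ ≤ Real.exp ((L : ℝ) * h) *
        ∑ _t : (Fin k → Fin N) → Fin (L + 1), k * (N : ℝ) ^ (2 * k) := by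
      gcongr with t
      exact hGsum t
    _ = _ := by simp

theorem eventually_mul_succ_pow_le_exp (C : ℝ) (d : ℕ) {ε : ℝ} (hε : 0 < ε) :
    ∀ᶠ n : ℕ in Filter.atTop, ((n + 1 : ℕ) : ℝ) ^ d * C ≤ Real.exp (n * ε) := by
  have ho := (isLittleO_pow_exp_pos_mul_atTop d hε).comp_tendsto
    (tendsto_natCast_atTop_atTop (R := ℝ))
  have hc : 0 < 1 / ((|C| + 1) * Real.exp ε) := by positivity
  filter_upwards [(Filter.tendsto_add_atTop_nat 1).eventually (ho.def hc)] with n hn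
  simp only [Function.comp_apply, Real.norm_eq_abs, Real.abs_exp] at hn
  rw [abs_of_nonneg (by positivity)] at hn
  have hexp : Real.exp (ε * ((n + 1 : ℕ) : ℝ)) = Real.exp (n * ε) * Real.exp ε := by
    rw [← Real.exp_add]
    push_cast
    ring_nf
  calc ((n + 1 : ℕ) : ℝ) ^ d * C ≤ ((n + 1 : ℕ) : ℝ) ^ d * (|C| + 1) := by
        gcongr
        linarith [le_abs_self C]
    _ ≤ 1 / ((|C| + 1) * Real.exp ε) * Real.exp (ε * ((n + 1 : ℕ) : ℝ)) * (|C| + 1) := by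
        gcongr
    _ = Real.exp (n * ε) := by
        rw [hexp]
        field_simp

/-- For fixed `N ≥ 1`, `k ≥ 1` and any `h > 0`, `ε > 0`, for all sufficiently large `n` the
number of words `ω ∈ {1,…,N}^n` with `H_k(ω) ≤ k h` is at most `exp(n(h+ε))`. -/
theorem stmt7 (N k : ℕ) (hN : 1 ≤ N) (hk : 1 ≤ k) (h ε : ℝ) (hh : 0 < h) (hε : 0 < ε) :
    ∃ n₀ : ℕ, ∀ n, n₀ ≤ n →
      (Set.ncard {ω : Fin n → Fin N | entH k ω ≤ (k : ℝ) * h} : ℝ) ≤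
        Real.exp ((n : ℝ) * (h + ε)) := by
  obtain ⟨n₁, hn₁⟩ := Filter.eventually_atTop.1
    (eventually_mul_succ_pow_le_exp (k * (N : ℝ) ^ (2 * k)) (N ^ k) hε)
  refine ⟨max n₁ (2 * k), fun n hn => ?_⟩
  have hkn : 2 * k ≤ n := (le_max_right _ _).trans hn
  have hL : n + 1 - k ≤ n := by omega
  calc
    _ ≤ _ := ncard_entH_le hk hkn h
    _ ≤ Real.exp (n * h) * (((n + 1 : ℕ) : ℝ) ^ (N ^ k) * (k * (N : ℝ) ^ (2 * k))) := by
      gcongr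
    _ ≤ Real.exp (n * h) * Real.exp (n * ε) := by
      gcongr
      exact hn₁ n ((le_max_left _ _).trans hn)
    _ = _ := by rw [← Real.exp_add, mul_add]
end

section
/- Let p⃗ = (p_1, p_2, ...) be a frequency vector. For any sequence of positive integers (c_n)_{n≥1} tending to infinity, there exists an irrational z ∈ E_{p⃗} whose partial quotients satisfy a_n(z) ≤ c_n for all n ≥ 1. -/
open Filter

/-- `τ_j(x,n) = Card {1 ≤ m ≤ n : a_m(x) = j}`. -/
noncomputable def freqCount (x : ℝ) (j n : ℕ) : ℕ :=
  ((Finset.Icc 1 n).filter fun m => cfDigit x m = j).card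

/-- The set `E_p = {x ∈ [0,1) irrational : τ_j(x) = p_j for all j ≥ 1}` of numbers whose
partial quotients have prescribed frequencies. -/
def Efreq (p : ℕ → ℝ) : Set ℝ :=
  {x | x ∈ Set.Ico (0 : ℝ) 1 ∧ Irrational x ∧
    ∀ j, 1 ≤ j → Tendsto (fun n => (freqCount x j n : ℝ) / n) atTop (nhds (p j))}

open MeasureTheory ProbabilityTheory

/-- Finite continued fractions: a solution of the first `N` of the equations
`y k * (a k + y (k + 1)) = 1`. -/
theorem exists_partial_tails (N : ℕ) : ∀ a : ℕ → ℕ, (∀ n, 1 ≤ a n) →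
    ∃ y : ℕ → ℝ, (∀ k, y k ∈ Set.Icc (0 : ℝ) 1) ∧
      ∀ k < N, y k * (a k + y (k + 1)) = 1 := by
  induction N with
  | zero => exact fun a _ => ⟨fun _ => 0, by simp, by simp⟩
  | succ N ih =>
    intro a ha
    obtain ⟨y, hy, hrec⟩ := ih (fun n => a (n + 1)) fun n => ha _
    have h1 : (1 : ℝ) ≤ a 0 + y 0 := by
      have : (1 : ℝ) ≤ a 0 := by exact_mod_cast ha 0
      linarith [(hy 0).1]
    have h0 : 0 < a 0 + y 0 := by linarith
    refine ⟨fun k => Nat.casesOn k (1 / (a 0 + y 0)) y, ?_, ?_⟩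
    · rintro (_ | k)
      · exact ⟨one_div_nonneg.2 h0.le, (div_le_one h0).2 h1⟩
      · exact hy k
    · rintro (_ | k) hk
      · exact one_div_mul_cancel h0.ne'
      · exact hrec k (by omega)

/-- Every sequence of positive digits admits a sequence of continued fraction tails. -/
theorem exists_tails (a : ℕ → ℕ) (ha : ∀ n, 1 ≤ a n) :
    ∃ y : ℕ → ℝ, (∀ k, y k ∈ Set.Icc (0 : ℝ) 1) ∧ ∀ k, y k * (a k + y (k + 1)) = 1 := by
  let t : ℕ → Set (ℕ → ℝ) := fun N =>
    (Set.univ.pi fun _ => Set.Icc (0 : ℝ) 1) ∩ {y | ∀ k < N, y k * (a k + y (k + 1)) = 1}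
  have hcl : ∀ N, IsClosed {y : ℕ → ℝ | ∀ k < N, y k * (a k + y (k + 1)) = 1} := by
    intro N
    simp only [Set.ofPred_forall]
    exact isClosed_iInter fun k => isClosed_iInter fun _ =>
      isClosed_eq (by fun_prop) continuous_const
  have hK : IsCompact (Set.univ.pi fun _ : ℕ => Set.Icc (0 : ℝ) 1) :=
    isCompact_univ_pi fun _ => isCompact_Icc
  obtain ⟨y, hy⟩ := IsCompact.nonempty_iInter_of_sequence_nonempty_isCompact_isClosed t
    (fun N y hy => ⟨hy.1, fun k hk => hy.2 k (by omega)⟩)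
    (fun N => by
      obtain ⟨y, h1, h2⟩ := exists_partial_tails N a ha
      exact ⟨y, fun k _ => h1 k, h2⟩)
    (hK.inter_right (hcl 0)) (fun N => hK.isClosed.inter (hcl N))
  rw [Set.mem_iInter] at hy
  exact ⟨y, fun k => (hy 0).1 k trivial, fun k => (hy (k + 1)).2 k k.lt_succ_self⟩

section Tails

variable {a : ℕ → ℕ} {y : ℕ → ℝ}

theorem tail_mem_Ioo (ha : ∀ n, 1 ≤ a n) (hy : ∀ k, y k ∈ Set.Icc (0 : ℝ) 1)
    (hrec : ∀ k, y k * (a k + y (k + 1)) = 1) (k : ℕ) : y k ∈ Set.Ioo (0 : ℝ) 1 := by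
  have hpos : ∀ k, 0 < y k := fun k =>
    (hy k).1.lt_of_ne fun h => by simpa [← h] using hrec k
  have h1 : (1 : ℝ) ≤ a k := by exact_mod_cast ha k
  refine ⟨hpos k, ?_⟩
  nlinarith [hrec k, hpos k, hpos (k + 1), mul_pos (hpos k) (hpos (k + 1))]

theorem one_div_tail (hrec : ∀ k, y k * (a k + y (k + 1)) = 1) (k : ℕ) :
    1 / y k = a k + y (k + 1) := by
  rw [one_div]
  exact inv_eq_of_mul_eq_one_right (hrec k)

theorem gaussMap_iterate_tail (hy : ∀ k, y k ∈ Set.Ioo (0 : ℝ) 1)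
    (hrec : ∀ k, y k * (a k + y (k + 1)) = 1) (k : ℕ) : gaussMap^[k] (y 0) = y k := by
  induction k with
  | zero => rfl
  | succ k ih =>
    rw [Function.iterate_succ_apply', ih, gaussMap, if_neg (hy k).1.ne', one_div_tail hrec,
      Int.fract_natCast_add, Int.fract_eq_self.2 ⟨(hy _).1.le, (hy _).2⟩]

theorem cfDigit_tail (hy : ∀ k, y k ∈ Set.Ioo (0 : ℝ) 1)
    (hrec : ∀ k, y k * (a k + y (k + 1)) = 1) (k : ℕ) : cfDigit (y 0) (k + 1) = a k := by
  rw [cfDigit, Nat.add_sub_cancel, gaussMap_iterate_tail hy hrec, one_div_tail hrec,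
    Nat.floor_eq_iff (by have := (hy (k + 1)).1; positivity)]
  exact ⟨by linarith [(hy (k + 1)).1], by linarith [(hy (k + 1)).2]⟩

/-- Tails of an infinite continued fraction are irrational, by descent on the denominator. -/
theorem tail_mul_natCast_ne (hy : ∀ k, y k ∈ Set.Ioo (0 : ℝ) 1)
    (hrec : ∀ k, y k * (a k + y (k + 1)) = 1) (q : ℕ) :
    ∀ (k : ℕ) (m : ℤ), 0 < q → y k * q ≠ m := by
  induction q using Nat.strong_induction_on with
  | _ q ih =>
    intro k m hq h
    have hq' : (0 : ℝ) < q := by exact_mod_cast hq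
    have hm : 0 < m := by
      have : (0 : ℝ) < m := h ▸ mul_pos (hy k).1 hq'
      exact_mod_cast this
    have hmq : m < q := by
      have : (m : ℝ) < q := by nlinarith [(hy k).2]
      exact_mod_cast this
    lift m to ℕ using hm.le
    refine ih m (by omega) (k + 1) (q - a k * m) (by omega) ?_
    push_cast at h ⊢
    rw [← h]
    linear_combination (q : ℝ) * hrec k

theorem irrational_tail (hy : ∀ k, y k ∈ Set.Ioo (0 : ℝ) 1)
    (hrec : ∀ k, y k * (a k + y (k + 1)) = 1) (k : ℕ) : Irrational (y k) := by
  rintro ⟨r, hr⟩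
  refine tail_mul_natCast_ne hy hrec r.den k r.num r.den_pos ?_
  rw [← hr]
  exact_mod_cast r.mul_den_eq_num

end Tails

/-- Every sequence of positive integers is the digit sequence of an irrational in `[0, 1)`. -/
theorem exists_irrational_cfDigit_eq (a : ℕ → ℕ) (ha : ∀ n, 1 ≤ a n) :
    ∃ z ∈ Set.Ico (0 : ℝ) 1, Irrational z ∧ ∀ n, cfDigit z (n + 1) = a n := by
  obtain ⟨y, hy, hrec⟩ := exists_tails a ha
  have hy' := tail_mem_Ioo ha hy hrec
  exact ⟨y 0, Set.Ioo_subset_Ico_self (hy' 0), irrational_tail hy' hrec 0,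
    cfDigit_tail hy' hrec⟩

/-- Every probability vector is the vector of frequencies of some sequence, by the strong law of
large numbers. -/
theorem exists_seq_tendsto_frequency (q : ℕ → ℝ) (hq : ∀ j, 0 ≤ q j) (hsum : HasSum q 1) :
    ∃ b : ℕ → ℕ, ∀ j,
      Tendsto (fun n : ℕ => (((Finset.range n).filter fun i => b i = j).card : ℝ) / n)
        atTop (nhds (q j)) := by
  have hsum' : HasSum (fun j => ENNReal.ofReal (q j)) 1 := by
    rw [← ENNReal.ofReal_one, ← hsum.tsum_eq,
      ENNReal.ofReal_tsum_of_nonneg hq hsum.summable]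
    exact ENNReal.summable.hasSum
  let P : PMF ℕ := ⟨fun j => ENNReal.ofReal (q j), hsum'⟩
  let μ : Measure (ℕ → ℕ) := Measure.infinitePi fun _ => P.toMeasure
  have hmp : ∀ i, MeasurePreserving (fun ω : ℕ → ℕ => ω i) μ P.toMeasure :=
    fun i => measurePreserving_eval_infinitePi _ i
  have hind : iIndepFun (fun i (ω : ℕ → ℕ) => ω i) μ :=
    iIndepFun_infinitePi (X := fun _ => id) fun _ => measurable_id
  have key : ∀ j, ∀ᵐ ω ∂μ,
      Tendsto (fun n : ℕ => (((Finset.range n).filter fun i => ω i = j).card : ℝ) / n)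
        atTop (nhds (q j)) := by
    intro j
    let g : ℕ → ℝ := Set.indicator {j} 1
    have hg : Measurable g := measurable_of_countable _
    have hgint : Integrable g P.toMeasure :=
      (integrable_const (1 : ℝ)).indicator (MeasurableSet.singleton j)
    have hlaw := strong_law_ae_real (μ := μ) (fun i ω => g (ω i))
      ((hmp 0).integrable_comp_of_integrable hgint)
      (fun i k hik => (hind.indepFun hik).comp hg hg)
      (fun i => IdentDistrib.comp ⟨(hmp i).aemeasurable, (hmp 0).aemeasurable,
        (hmp i).map_eq.trans (hmp 0).map_eq.symm⟩ hg)
    have hmean : ∫ ω, g (ω 0) ∂μ = q j := by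
      have h1 : ∫ ω, g (ω 0) ∂μ = ∫ x, g x ∂P.toMeasure := by
        rw [← (hmp 0).map_eq, integral_map (hmp 0).aemeasurable hg.aestronglyMeasurable]
      rw [h1, integral_indicator_one (MeasurableSet.singleton j), measureReal_def,
        P.toMeasure_apply_singleton j (MeasurableSet.singleton j)]
      exact ENNReal.toReal_ofReal (hq j)
    filter_upwards [hlaw] with ω hω
    rw [hmean] at hω
    refine hω.congr fun n => ?_
    simp [g, Pi.single_apply]
  obtain ⟨b, hb⟩ := (ae_all_iff.2 key).exists
  exact ⟨b, hb⟩

/-- If `b` has frequency vector `q` of total mass one and `d → ∞`, then the set of indices with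
`d i ≤ b i` has density zero. -/
theorem tendsto_density_exceed {q : ℕ → ℝ} (hsum : HasSum q 1) {b d : ℕ → ℕ}
    (hb : ∀ j, Tendsto (fun n : ℕ => (((Finset.range n).filter fun i => b i = j).card : ℝ) / n)
      atTop (nhds (q j))) (hd : Tendsto d atTop atTop) :
    Tendsto (fun n : ℕ => (((Finset.range n).filter fun i => d i ≤ b i).card : ℝ) / n)
      atTop (nhds 0) := by
  refine tendsto_order.2 ⟨fun x hx => .of_forall fun n => hx.trans_le (by positivity),
    fun ε hε => ?_⟩
  obtain ⟨K, hK⟩ := ((tendsto_order.1 hsum.tendsto_sum_nat).1 (1 - ε) (by linarith)).exists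
  obtain ⟨N, hN⟩ := eventually_atTop.1 (hd.eventually_ge_atTop K)
  have hlim : Tendsto (fun n : ℕ => (N : ℝ) / n + (1 - ∑ j ∈ Finset.range K,
      (((Finset.range n).filter fun i => b i = j).card : ℝ) / n)) atTop
      (nhds (0 + (1 - ∑ j ∈ Finset.range K, q j))) :=
    (tendsto_const_div_atTop_nhds_zero_nat _).add
      (tendsto_const_nhds.sub (tendsto_finsetSum _ fun j _ => hb j))
  filter_upwards [(tendsto_order.1 hlim).2 ε (by linarith), eventually_gt_atTop 0] with n hn hn0
  refine lt_of_le_of_lt ?_ hn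
  have hn0' : (0 : ℝ) < n := by exact_mod_cast hn0
  have hcount : ∑ j ∈ Finset.range K, ((Finset.range n).filter fun i => b i = j).card =
      ((Finset.range n).filter fun i => b i < K).card := by
    rw [Finset.card_eq_sum_card_fiberwise (f := b) (t := Finset.range K)
      (fun i hi => by simpa using (Finset.mem_filter.1 hi).2)]
    refine Finset.sum_congr rfl fun j hj => ?_
    rw [Finset.filter_filter]
    congr 1
    ext i
    simp only [Finset.mem_filter, Finset.mem_range] at hj ⊢
    omega
  have hcover : ((Finset.range n).filter fun i => d i ≤ b i) ⊆
      Finset.range N ∪ ((Finset.range n).filter fun i => ¬ b i < K) := by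
    intro i hi
    simp only [Finset.mem_filter, Finset.mem_range, Finset.mem_union] at hi ⊢
    by_cases h : i < N
    · exact .inl h
    · have := hN i (by omega)
      exact .inr ⟨hi.1, by omega⟩
  have hle := (Finset.card_le_card hcover).trans (Finset.card_union_le _ _)
  have hsplit := Finset.card_filter_add_card_filter_not (s := Finset.range n) fun i => b i < K
  rw [Finset.card_range] at hle hsplit
  rw [← hcount] at hsplit
  rw [← Finset.sum_div, one_sub_div hn0'.ne', ← add_div]
  refine div_le_div_of_nonneg_right ?_ hn0'.le
  have hle' : ((((Finset.range n).filter fun i => d i ≤ b i).card : ℕ) : ℝ) ≤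
      N + ((Finset.range n).filter fun i => ¬ b i < K).card := by exact_mod_cast hle
  have hsplit' : (∑ j ∈ Finset.range K,
      (((Finset.range n).filter fun i => b i = j).card : ℝ)) +
      ((Finset.range n).filter fun i => ¬ b i < K).card = n := by exact_mod_cast hsplit
  linarith

/-- Changing a sequence on a set of density zero does not affect its frequencies. -/
theorem tendsto_frequency_of_eq_off_null {a b : ℕ → ℕ} {r : ℕ → Prop} [DecidablePred r]
    (hab : ∀ i, ¬ r i → a i = b i)
    (hr : Tendsto (fun n : ℕ => (((Finset.range n).filter r).card : ℝ) / n) atTop (nhds 0))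
    {j : ℕ} {x : ℝ}
    (hb : Tendsto (fun n : ℕ => (((Finset.range n).filter fun i => b i = j).card : ℝ) / n)
      atTop (nhds x)) :
    Tendsto (fun n : ℕ => (((Finset.range n).filter fun i => a i = j).card : ℝ) / n)
      atTop (nhds x) := by
  have hle : ∀ (u v : ℕ → ℕ), (∀ i, ¬ r i → u i = v i) → ∀ n : ℕ,
      (((Finset.range n).filter fun i => u i = j).card : ℝ) ≤
        ((Finset.range n).filter fun i => v i = j).card + ((Finset.range n).filter r).card := by
    intro u v huv n
    have hsub : ((Finset.range n).filter fun i => u i = j) ⊆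
        ((Finset.range n).filter fun i => v i = j) ∪ (Finset.range n).filter r := by
      intro i hi
      simp only [Finset.mem_filter, Finset.mem_union] at hi ⊢
      by_cases h : r i
      · exact .inr ⟨hi.1, h⟩
      · exact .inl ⟨hi.1, huv i h ▸ hi.2⟩
    exact_mod_cast (Finset.card_le_card hsub).trans (Finset.card_union_le _ _)
  have hlo := hb.sub hr
  have hhi := hb.add hr
  rw [sub_zero] at hlo
  rw [add_zero] at hhi
  refine tendsto_of_tendsto_of_tendsto_of_le_of_le hlo hhi (fun n => ?_) fun n => ?_
  · change _ / _ - _ / _ ≤ _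
    rw [← sub_div]
    exact div_le_div_of_nonneg_right
      (by linarith [hle b a (fun i hi => (hab i hi).symm) n]) n.cast_nonneg
  · change _ ≤ _ / _ + _ / _
    rw [← add_div]
    exact div_le_div_of_nonneg_right (hle a b hab n) n.cast_nonneg

theorem freqCount_eq_card_filter_range {z : ℝ} {a : ℕ → ℕ}
    (h : ∀ n, cfDigit z (n + 1) = a n) (j n : ℕ) :
    freqCount z j n = ((Finset.range n).filter fun i => a i = j).card := by
  have hIcc : Finset.Icc 1 n = Finset.Ico (0 + 1) (n + 1) := by
    ext i
    simp
  rw [freqCount, Finset.card_filter, Finset.card_filter, Finset.range_eq_Ico, hIcc,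
    ← Finset.sum_Ico_add' (fun m => if cfDigit z m = j then 1 else 0) 0 n 1]
  simp [h]

/-- For any frequency vector `p` and any sequence of positive integers `c_n → ∞`, there is an
irrational `z ∈ E_p` whose partial quotients satisfy `a_n(z) ≤ c_n` for all `n ≥ 1`. -/
theorem stmt13 (p : ℕ → ℝ) (hp : ∀ j, 0 ≤ p j) (hsum : HasSum (fun j => p (j + 1)) 1)
    (c : ℕ → ℕ) (hc : ∀ n, 1 ≤ c n) (hctop : Tendsto c atTop atTop) :
    ∃ z : ℝ, z ∈ Efreq p ∧ ∀ n, 1 ≤ n → cfDigit z n ≤ c n := by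
  obtain ⟨b, hb⟩ := exists_seq_tendsto_frequency (fun j => p (j + 1)) (fun j => hp _) hsum
  let a : ℕ → ℕ := fun i => if c (i + 1) ≤ b i then 1 else b i + 1
  obtain ⟨z, hz, hirr, hdig⟩ := exists_irrational_cfDigit_eq a fun i => by
    dsimp only [a]
    split_ifs <;> omega
  refine ⟨z, ⟨hz, hirr, fun j hj => ?_⟩, fun n hn => ?_⟩
  · obtain ⟨j, rfl⟩ := Nat.exists_eq_add_of_le' hj
    simp only [freqCount_eq_card_filter_range hdig]
    refine tendsto_frequency_of_eq_off_null (b := fun i => b i + 1)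
      (r := fun i => c (i + 1) ≤ b i) (fun i hi => if_neg hi)
      (tendsto_density_exceed hsum hb (hctop.comp (tendsto_add_atTop_nat 1))) ?_
    simpa using hb j
  · obtain ⟨n, rfl⟩ := Nat.exists_eq_add_of_le' hn
    rw [hdig]
    dsimp only [a]
    split_ifs
    · exact hc _
    · omega
end

section
/- Let p⃗ be a frequency vector, let z ∈ E_{p⃗} with partial quotients a_m(z), and let b > 1. Define F_z(b) = { x ∈ [0,1) ∩ ℚ^c : a_{k²}(x) ∈ (b^{k²}, 2b^{k²}] for every k ≥ 1, and a_m(x) = a_m(z) for every m ≥ 1 that is not a perfect square }. Then F_z(b) ⊆ E_{p⃗}. -/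
open Filter

/-- The Cantor-like set `F_z(b)`: irrationals `x ∈ [0,1)` with `a_{k²}(x) ∈ (b^{k²}, 2b^{k²}]`
for all `k ≥ 1`, and `a_m(x) = a_m(z)` for all non-square `m ≥ 1`. -/
def Fzb (z : ℝ) (b : ℝ) : Set ℝ :=
  {x | x ∈ Set.Ico (0 : ℝ) 1 ∧ Irrational x ∧
    (∀ k, 1 ≤ k → b ^ (k ^ 2) < (cfDigit x (k ^ 2) : ℝ) ∧
      (cfDigit x (k ^ 2) : ℝ) ≤ 2 * b ^ (k ^ 2)) ∧
    ∀ m, 1 ≤ m → (¬∃ k, m = k ^ 2) → cfDigit x m = cfDigit z m}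

/-- The number of `m ∈ [1, n]` that are perfect squares is at most `√n`. -/
theorem card_filter_isSq_le [DecidablePred fun m : ℕ => ∃ k, m = k ^ 2] (n : ℕ) :
    ((Finset.Icc 1 n).filter fun m => ∃ k, m = k ^ 2).card ≤ n.sqrt := by
  calc ((Finset.Icc 1 n).filter fun m => ∃ k, m = k ^ 2).card
      ≤ ((Finset.Icc 1 n.sqrt).image fun k => k ^ 2).card := by
        refine Finset.card_le_card fun m hm => ?_
        simp only [Finset.mem_filter, Finset.mem_Icc, Finset.mem_image] at hm ⊢
        obtain ⟨⟨h1, h2⟩, k, rfl⟩ := hm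
        exact ⟨k, ⟨Nat.pos_of_ne_zero (by rintro rfl; simp at h1), Nat.le_sqrt'.2 h2⟩, rfl⟩
    _ ≤ (Finset.Icc 1 n.sqrt).card := Finset.card_image_le
    _ = n.sqrt := by simp

/-- Changing partial quotients only at perfect squares changes `τ_j(·, n)` by at most `√n`. -/
theorem freqCount_le_add_sqrt {x y : ℝ}
    (h : ∀ m, 1 ≤ m → (¬∃ k, m = k ^ 2) → cfDigit x m = cfDigit y m) (j n : ℕ) :
    freqCount x j n ≤ freqCount y j n + n.sqrt := by
  classical
  calc freqCount x j n
      ≤ (((Finset.Icc 1 n).filter fun m => cfDigit y m = j) ∪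
          (Finset.Icc 1 n).filter fun m => ∃ k, m = k ^ 2).card := by
        refine Finset.card_le_card fun m hm => ?_
        simp only [Finset.mem_filter, Finset.mem_Icc, Finset.mem_union] at hm ⊢
        by_cases hs : ∃ k, m = k ^ 2
        · exact Or.inr ⟨hm.1, hs⟩
        · exact Or.inl ⟨hm.1, h m hm.1.1 hs ▸ hm.2⟩
    _ ≤ _ := (Finset.card_union_le _ _).trans (Nat.add_le_add_left (card_filter_isSq_le n) _)

theorem tendsto_natSqrt_div_atTop :
    Tendsto (fun n : ℕ => (n.sqrt : ℝ) / n) atTop (nhds 0) := by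
  have h : Tendsto (fun n : ℕ => (√(n : ℝ))⁻¹) atTop (nhds 0) :=
    (Real.tendsto_sqrt_atTop.comp tendsto_natCast_atTop_atTop).inv_tendsto_atTop
  refine squeeze_zero (fun n => by positivity) (fun n => ?_) h
  rw [← Real.sqrt_div_self]
  gcongr
  exact Real.nat_sqrt_le_real_sqrt

/-- If `z ∈ E_p` and `b > 1`, then `F_z(b) ⊆ E_p`. -/
theorem stmt15 (p : ℕ → ℝ) (hp : ∀ j, 0 ≤ p j) (hsum : HasSum (fun j => p (j + 1)) 1)
    (z : ℝ) (hz : z ∈ Efreq p) (b : ℝ) (hb : 1 < b) :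
    Fzb z b ⊆ Efreq p := by
  rintro x ⟨hx, hirr, -, hdig⟩
  refine ⟨hx, hirr, fun j hj => ?_⟩
  have hdiff : Tendsto (fun n => (freqCount x j n : ℝ) / n - (freqCount z j n : ℝ) / n)
      atTop (nhds 0) := by
    refine squeeze_zero_norm (fun n => ?_) tendsto_natSqrt_div_atTop
    have h1 : (freqCount x j n : ℝ) ≤ freqCount z j n + n.sqrt := by
      exact_mod_cast freqCount_le_add_sqrt hdig j n
    have h2 : (freqCount z j n : ℝ) ≤ freqCount x j n + n.sqrt := by
      exact_mod_cast freqCount_le_add_sqrt (fun m hm hs => (hdig m hm hs).symm) j n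
    rw [← sub_div, norm_div, Real.norm_natCast, Real.norm_eq_abs]
    gcongr
    exact abs_sub_le_iff.2 ⟨by linarith, by linarith⟩
  simpa using hdiff.add (hz.2.2 j hj)
end

section
/- For every frequency vector p⃗, the Hausdorff dimension of E_{p⃗} satisfies dim_H(E_{p⃗}) ≥ 1/2. -/
open Filter

open MeasureTheory ProbabilityTheory in
/-- A probability vector is realised as the vector of asymptotic frequencies of a sequence. -/
lemma exists_seq_frequency (p : ℕ → ℝ) (hp : ∀ j, 0 ≤ p j) (hsum : HasSum p 1) :
    ∃ w : ℕ → ℕ, ∀ j, Tendsto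
      (fun n : ℕ => (∑ i ∈ Finset.range n, if w i = j then (1 : ℝ) else 0) / n) atTop
      (nhds (p j)) := by
  have hs : HasSum (fun j => ENNReal.ofReal (p j)) 1 := by
    have h := ENNReal.ofReal_tsum_of_nonneg hp hsum.summable
    rw [hsum.tsum_eq, ENNReal.ofReal_one] at h
    exact h ▸ ENNReal.summable.hasSum
  let P : PMF ℕ := ⟨fun j => ENNReal.ofReal (p j), hs⟩
  obtain ⟨Ω, mΩ, μ, X, hXm, hX, hind, hμ⟩ := exists_iid ℕ P.toMeasure
  have key : ∀ j : ℕ, ∀ᵐ ω ∂μ, Tendsto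
      (fun n : ℕ => (∑ i ∈ Finset.range n, if X i ω = j then (1 : ℝ) else 0) / n) atTop
      (nhds (p j)) := by
    intro j
    let g : ℕ → ℝ := ({j} : Set ℕ).indicator 1
    have hg : Measurable g := measurable_of_countable g
    have hident : ∀ i, IdentDistrib (fun ω => g (X i ω)) (fun ω => g (X 0 ω)) μ μ := fun i =>
      ((hX i).identDistrib (hX 0)).comp hg
    have hint : Integrable (fun ω => g (X 0 ω)) μ := by
      refine Integrable.of_bound (C := 1) (hg.comp (hXm 0)).aestronglyMeasurable ?_
      refine .of_forall fun ω => ?_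
      by_cases h : X 0 ω = j <;> simp [g, h]
    have hpair : Pairwise fun i k => IndepFun (fun ω => g (X i ω)) (fun ω => g (X k ω)) μ :=
      fun i k hik => (hind.indepFun hik).comp hg hg
    have hmean : ∫ ω, g (X 0 ω) ∂μ = p j := by
      have h1 : (fun ω => g (X 0 ω)) = (X 0 ⁻¹' {j}).indicator 1 := by
        ext ω; by_cases h : X 0 ω = j <;> simp [g, h]
      have h2 : μ (X 0 ⁻¹' {j}) = ENNReal.ofReal (p j) := by
        rw [← Measure.map_apply (hXm 0) (measurableSet_singleton j), (hX 0).map_eq,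
          P.toMeasure_apply_singleton j (measurableSet_singleton j)]
        rfl
      rw [h1, integral_indicator_one (hXm 0 (measurableSet_singleton j)), measureReal_def, h2,
        ENNReal.toReal_ofReal (hp j)]
    have hslln := strong_law_ae_real (fun i ω => g (X i ω)) hint hpair hident
    rw [hmean] at hslln
    filter_upwards [hslln] with ω hω
    refine hω.congr fun n => ?_
    congr 1
    exact Finset.sum_congr rfl fun i _ => by simp [g, Pi.single_apply]
  obtain ⟨ω, hω⟩ := (ae_all_iff.2 key).exists
  exact ⟨fun i => X i ω, hω⟩

/-- `y` is the sequence of complete quotients (inverted) of a continued fraction with partial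
quotients `a`. -/
def IsCFOrbit (a : ℕ → ℕ) (y : ℕ → ℝ) : Prop :=
  ∀ n, 0 < y n ∧ y n < 1 ∧ y n * (a n + y (n + 1)) = 1

lemma exists_finite_orbit (N : ℕ) : ∀ a : ℕ → ℕ, (∀ n, 1 ≤ a n) →
    ∃ y : ℕ → ℝ, (∀ n, y n ∈ Set.Icc (0 : ℝ) 1) ∧ ∀ n < N, y n * (a n + y (n + 1)) = 1 := by
  induction N with
  | zero => exact fun a _ => ⟨0, by simp, by simp⟩
  | succ N ih =>
    intro a ha
    obtain ⟨y, hy, hy'⟩ := ih (fun n => a (n + 1)) fun n => ha _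
    have h1 : (1 : ℝ) ≤ a 0 + y 0 := by
      have : (1 : ℝ) ≤ a 0 := by exact_mod_cast ha 0
      linarith [(hy 0).1]
    refine ⟨fun n => Nat.casesOn n (1 / (a 0 + y 0)) y, ?_, ?_⟩
    · rintro (_ | n)
      · exact ⟨one_div_nonneg.2 (by linarith), (div_le_one (by linarith)).2 h1⟩
      · exact hy n
    · rintro (_ | n) hn
      · exact one_div_mul_cancel (by linarith)
      · exact hy' n (by omega)

lemma exists_isCFOrbit (a : ℕ → ℕ) (ha : ∀ n, 1 ≤ a n) : ∃ y, IsCFOrbit a y := by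
  let C : ℕ → Set (ℕ → ℝ) := fun N =>
    (Set.univ.pi fun _ => Set.Icc (0 : ℝ) 1) ∩ {y | ∀ n < N, y n * (a n + y (n + 1)) = 1}
  have hclosed : ∀ N, IsClosed (C N) := fun N => by
    refine (isClosed_set_pi fun _ _ => isClosed_Icc).inter ?_
    simp only [Set.ofPred_forall]
    refine isClosed_iInter fun n => isClosed_iInter fun _ => isClosed_eq ?_ ?_ <;> fun_prop
  have hne : (⋂ N, C N).Nonempty := by
    refine IsCompact.nonempty_iInter_of_sequence_nonempty_isCompact_isClosed C
      (fun N y hy => ⟨hy.1, fun n hn => hy.2 n (by omega)⟩) (fun N => ?_) ?_ hclosed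
    · obtain ⟨y, hy, hy'⟩ := exists_finite_orbit N a ha
      exact ⟨y, fun n _ => hy n, hy'⟩
    · exact (isCompact_univ_pi fun _ => isCompact_Icc).of_isClosed_subset (hclosed 0) fun y hy => hy.1
  obtain ⟨y, hy⟩ := hne
  rw [Set.mem_iInter] at hy
  have h0 : ∀ n, 0 ≤ y n := fun n => ((hy 0).1 n trivial).1
  have he : ∀ n, y n * (a n + y (n + 1)) = 1 := fun n => (hy (n + 1)).2 n (by omega)
  have hpos : ∀ n, 0 < y n := fun n => (h0 n).lt_of_ne fun h => by
    have := he n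
    rw [← h] at this
    simp at this
  refine ⟨y, fun n => ⟨hpos n, ?_, he n⟩⟩
  have h1 : (1 : ℝ) ≤ a n := by exact_mod_cast ha n
  nlinarith [hpos n, hpos (n + 1), he n, mul_pos (hpos n) (hpos (n + 1))]

namespace IsCFOrbit

variable {a b : ℕ → ℕ} {y u : ℕ → ℝ}

lemma one_div_eq (h : IsCFOrbit a y) (n : ℕ) : 1 / y n = a n + y (n + 1) :=
  (eq_one_div_of_mul_eq_one_right (h n).2.2).symm

lemma iterate_gaussMap (h : IsCFOrbit a y) (n : ℕ) : gaussMap^[n] (y 0) = y n := by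
  induction n with
  | zero => rfl
  | succ n ih =>
    rw [Function.iterate_succ_apply', ih, gaussMap, if_neg (h n).1.ne', h.one_div_eq,
      Int.fract_natCast_add, Int.fract_eq_self.2 ⟨(h _).1.le, (h _).2.1⟩]

lemma cfDigit_succ (h : IsCFOrbit a y) (n : ℕ) : cfDigit (y 0) (n + 1) = a n := by
  rw [cfDigit, Nat.add_sub_cancel, h.iterate_gaussMap, h.one_div_eq, add_comm,
    Nat.floor_add_natCast (h _).1.le, Nat.floor_eq_zero.2 (h _).2.1, zero_add]

lemma irrational (h : IsCFOrbit a y) : Irrational (y 0) := by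
  have key : ∀ q : ℕ, ∀ n, ∀ p : ℕ, 0 < q → y n * q ≠ p := by
    intro q
    induction q using Nat.strong_induction_on with
    | _ q ih =>
      intro n p hq he
      have hq' : (0 : ℝ) < q := by exact_mod_cast hq
      obtain ⟨h1, h2, h3⟩ := h n
      have hp : 0 < p := by
        have : (0 : ℝ) < p := he ▸ mul_pos h1 hq'
        exact_mod_cast this
      have hpq : p < q := by
        have : (p : ℝ) < q := by rw [← he]; nlinarith
        exact_mod_cast this
      have h5 : y (n + 1) * p = q - a n * p := by
        rw [← he]
        linear_combination (q : ℝ) * h3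
      have h6 : a n * p ≤ q := by
        have : (0 : ℝ) ≤ q - a n * p := h5 ▸ mul_nonneg (h _).1.le (Nat.cast_nonneg p)
        have : ((a n * p : ℕ) : ℝ) ≤ q := by push_cast; linarith
        exact_mod_cast this
      refine ih p hpq (n + 1) (q - a n * p) hp ?_
      rw [h5]
      push_cast [h6]
      ring
  rintro ⟨r, hr⟩
  have hr0 : 0 ≤ r := by
    have := (h 0).1
    rw [← hr] at this
    exact_mod_cast this.le
  refine key r.den 0 r.num.toNat r.den_pos ?_
  rw [← hr]
  have h1 : ((r.num.toNat : ℤ) : ℚ) = r.num := by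
    rw [Int.toNat_of_nonneg (Rat.num_nonneg.2 hr0)]
  have h2 : r * r.den = (r.num.toNat : ℚ) := by
    rw [Rat.mul_den_eq_num, ← h1, Int.cast_natCast]
  exact_mod_cast h2

lemma freqCount_eq (h : IsCFOrbit a y) (j n : ℕ) :
    (freqCount (y 0) j n : ℝ) = ∑ i ∈ Finset.range n, if a i = j then (1 : ℝ) else 0 := by
  induction n with
  | zero => simp [freqCount]
  | succ n ih =>
    rw [Finset.sum_range_succ, ← ih, freqCount, freqCount, Finset.card_filter, Finset.card_filter,
      Finset.sum_Icc_succ_top (by omega), h.cfDigit_succ]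
    push_cast
    rfl

/-- The inverse branches of the Gauss map do not contract too much. -/
lemma abs_sub_mul (h : IsCFOrbit a y) (h' : IsCFOrbit b u) (n : ℕ) :
    |y n - u n| * ((a n + y (n + 1)) * (b n + u (n + 1))) =
      |(a n : ℝ) + y (n + 1) - (b n + u (n + 1))| := by
  have h1 := (h n).2.2
  have h2 := (h' n).2.2
  have h3 : (0 : ℝ) ≤ (a n + y (n + 1)) * (b n + u (n + 1)) :=
    mul_nonneg (add_nonneg (Nat.cast_nonneg _) (h _).1.le)
      (add_nonneg (Nat.cast_nonneg _) (h' _).1.le)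
  rw [← abs_of_nonneg h3, ← abs_mul, abs_sub_comm (_ + _)]
  congr 1
  linear_combination (b n + u (n + 1)) * h1 - (a n + y (n + 1)) * h2

lemma abs_sub_le (h : IsCFOrbit a y) (h' : IsCFOrbit b u) (n : ℕ) :
    |(a n : ℝ) + y (n + 1) - (b n + u (n + 1))| ≤ |y n - u n| * ((a n + 1) * (b n + 1)) := by
  rw [← h.abs_sub_mul h' n]
  have := (h (n + 1)).2.1
  have := (h' (n + 1)).2.1
  have := (h' (n + 1)).1
  gcongr

lemma abs_sub_le_prod (h : IsCFOrbit a y) (h' : IsCFOrbit b u) (n : ℕ)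
    (hab : ∀ i < n, a i = b i) :
    |y n - u n| ≤ |y 0 - u 0| * (∏ i ∈ Finset.range n, ((a i : ℝ) + 1)) ^ 2 := by
  induction n with
  | zero => simp
  | succ n ih =>
    have h1 := h.abs_sub_le h' n
    rw [← hab n (by omega), add_sub_add_left_eq_sub] at h1
    refine h1.trans ?_
    rw [Finset.prod_range_succ]
    calc _ ≤ (|y 0 - u 0| * (∏ i ∈ Finset.range n, ((a i : ℝ) + 1)) ^ 2) * _ := by
          gcongr
          exact ih fun i hi => hab i (by omega)
      _ = _ := by ring

/-- Separation of two points whose continued fractions first differ at index `n`, and agree again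
at index `n + 1`. -/
lemma abs_digit_sub_le (h : IsCFOrbit a y) (h' : IsCFOrbit b u) (n : ℕ)
    (hab : ∀ i < n, a i = b i) (hne : a n ≠ b n) (hn : a (n + 1) = b (n + 1))
    (hpos : 1 ≤ a (n + 1)) :
    |(a n : ℝ) - b n| ≤ 2 * (|y 0 - u 0| * (∏ i ∈ Finset.range n, ((a i : ℝ) + 1)) ^ 2 *
      ((a n + 1) * (b n + 1))) := by
  have h1 : |(a n : ℝ) + y (n + 1) - (b n + u (n + 1))| ≤
      |y 0 - u 0| * (∏ i ∈ Finset.range n, ((a i : ℝ) + 1)) ^ 2 * ((a n + 1) * (b n + 1)) :=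
    (h.abs_sub_le h' n).trans (by gcongr; exact h.abs_sub_le_prod h' n hab)
  have hd : (1 : ℝ) ≤ |(a n : ℝ) - b n| := by
    have : (1 : ℤ) ≤ |(a n : ℤ) - b n| := Int.one_le_abs (by omega)
    exact_mod_cast this
  have hc : (1 : ℝ) ≤ a (n + 1) := by exact_mod_cast hpos
  have hclose : |y (n + 1) - u (n + 1)| ≤ 1 / 2 := by
    have key : ∀ v s : ℝ, 0 < v → 0 < s → s < 1 → v * (a (n + 1) + s) = 1 →
        1 ≤ v * (a (n + 1) + 1) ∧ v * a (n + 1) ≤ 1 := fun v s hv hs hs' he => by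
      constructor <;> nlinarith
    obtain ⟨p1, p2, p3⟩ := h (n + 1)
    obtain ⟨q1, q2, q3⟩ := h' (n + 1)
    rw [← hn] at q3
    obtain ⟨k1, k2⟩ := key _ _ p1 (h _).1 (h _).2.1 p3
    obtain ⟨l1, l2⟩ := key _ _ q1 (h' _).1 (h' _).2.1 q3
    rw [abs_le]
    constructor <;> nlinarith
  have h3 : |(a n : ℝ) - b n| - |y (n + 1) - u (n + 1)| ≤
      |(a n : ℝ) + y (n + 1) - (b n + u (n + 1))| := by
    have := abs_sub_abs_le_abs_sub ((a n : ℝ) - b n) (-(y (n + 1) - u (n + 1)))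
    rwa [abs_neg, show (a n : ℝ) - b n - -(y (n + 1) - u (n + 1)) =
      a n + y (n + 1) - (b n + u (n + 1)) by ring] at this
  linarith

end IsCFOrbit

/-- The exponent of the `k`-th scale `2 ^ cubeSum k` used to encode a real number. -/
def cubeSum (k : ℕ) : ℕ := ∑ i ∈ Finset.range (k + 1), i ^ 3

lemma cubeSum_succ (k : ℕ) : cubeSum (k + 1) = cubeSum k + (k + 1) ^ 3 :=
  Finset.sum_range_succ _ _

lemma pow_four_le_cubeSum (k : ℕ) : k ^ 4 ≤ 4 * cubeSum k := by
  induction k with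
  | zero => simp
  | succ k ih =>
    rw [cubeSum_succ]
    nlinarith [Nat.zero_le (k ^ 3), Nat.zero_le (k ^ 2), Nat.zero_le k]

lemma le_cubeSum (k : ℕ) : k ≤ cubeSum k := by
  induction k with
  | zero => simp
  | succ k ih => rw [cubeSum_succ]; nlinarith [Nat.zero_le (k ^ 3), Nat.zero_le (k ^ 2)]

/-- Partial quotients given by (a truncation of) `w`, except at the perfect squares `k ^ 2`, where
they encode the `k`-th digit of `v` in a mixed radix expansion. -/
noncomputable def encodeDigits (w : ℕ → ℕ) (v : ℝ) (n : ℕ) : ℕ :=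
  if n.sqrt ^ 2 = n then
    2 ^ n.sqrt ^ 3 + ⌊(2 : ℝ) ^ cubeSum n.sqrt * v⌋₊ % 2 ^ n.sqrt ^ 3
  else min (w n) n + 1

section encodeDigits

variable (w : ℕ → ℕ) (v : ℝ)

lemma encodeDigits_sq (k : ℕ) : encodeDigits w v (k ^ 2) =
    2 ^ k ^ 3 + ⌊(2 : ℝ) ^ cubeSum k * v⌋₊ % 2 ^ k ^ 3 := by
  rw [encodeDigits, Nat.sqrt_eq', if_pos rfl]

lemma encodeDigits_of_ne {n : ℕ} (h : n.sqrt ^ 2 ≠ n) :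
    encodeDigits w v n = min (w n) n + 1 := if_neg h

lemma sqrt_sq_ne_of_lt {k n : ℕ} (h₁ : k ^ 2 < n) (h₂ : n < (k + 1) ^ 2) : n.sqrt ^ 2 ≠ n := by
  intro h
  rw [← h] at h₁ h₂
  have := lt_of_pow_lt_pow_left' 2 h₁
  have := lt_of_pow_lt_pow_left' 2 h₂
  omega

lemma one_le_encodeDigits (n : ℕ) : 1 ≤ encodeDigits w v n := by
  rw [encodeDigits]
  split_ifs
  · exact Nat.one_le_two_pow.trans (Nat.le_add_right _ _)
  · omega

lemma encodeDigits_sq_add_one_le (k : ℕ) : encodeDigits w v (k ^ 2) + 1 ≤ 2 ^ (k ^ 3 + 1) := by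
  rw [encodeDigits_sq, pow_succ]
  have := Nat.mod_lt ⌊(2 : ℝ) ^ cubeSum k * v⌋₊ (Nat.two_pow_pos (k ^ 3))
  omega

lemma sq_add_one_le_two_pow (m : ℕ) : m ^ 2 + 1 ≤ 2 ^ (m + 1) := by
  induction m with
  | zero => simp
  | succ m ih =>
    rcases lt_or_ge m 3 with h | h
    · interval_cases m <;> norm_num
    · rw [pow_succ 2 (m + 1)]
      nlinarith

lemma prod_encodeDigits_le (k : ℕ) :
    (∏ i ∈ Finset.range (k ^ 2), (encodeDigits w v i + 1)) * 2 ^ (k ^ 3 + 1) ≤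
      2 ^ (cubeSum k + 2 * k ^ 3 + 1) := by
  induction k with
  | zero => simp [cubeSum]
  | succ k ih =>
    have hsq : (k + 1) ^ 2 = k ^ 2 + 1 + 2 * k := by ring
    have hlt : k ^ 2 + 1 ≤ (k + 1) ^ 2 := by omega
    rw [← Finset.prod_range_mul_prod_Ico _ hlt, Finset.prod_range_succ]
    have hblock : ∏ i ∈ Finset.Ico (k ^ 2 + 1) ((k + 1) ^ 2), (encodeDigits w v i + 1) ≤
        (2 ^ (k + 2)) ^ (2 * k) := by
      have hcard : 2 * k = (Finset.Ico (k ^ 2 + 1) ((k + 1) ^ 2)).card := by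
        rw [Nat.card_Ico, hsq, Nat.add_sub_cancel_left]
      conv_rhs => rw [hcard]
      refine Finset.prod_le_pow_card _ _ _ fun i hi => ?_
      rw [Finset.mem_Ico] at hi
      rw [encodeDigits_of_ne w v (sqrt_sq_ne_of_lt hi.1 hi.2)]
      calc min (w i) i + 1 + 1 ≤ (k + 1) ^ 2 + 1 := by
            have := min_le_right (w i) i
            omega
        _ ≤ 2 ^ (k + 2) := sq_add_one_le_two_pow (k + 1)
    calc _ ≤ (∏ i ∈ Finset.range (k ^ 2), (encodeDigits w v i + 1)) * 2 ^ (k ^ 3 + 1) *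
          (2 ^ (k + 2)) ^ (2 * k) * 2 ^ ((k + 1) ^ 3 + 1) := by
          gcongr
          exact encodeDigits_sq_add_one_le w v k
      _ ≤ 2 ^ (cubeSum k + 2 * k ^ 3 + 1) * (2 ^ (k + 2)) ^ (2 * k) * 2 ^ ((k + 1) ^ 3 + 1) := by
          gcongr
      _ = 2 ^ (cubeSum k + 2 * k ^ 3 + 1 + (k + 2) * (2 * k) + ((k + 1) ^ 3 + 1)) := by
          rw [← pow_mul, ← pow_add, ← pow_add]
      _ ≤ _ := by
          refine Nat.pow_le_pow_right two_pos ?_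
          rw [cubeSum_succ]
          nlinarith

end encodeDigits

lemma card_filter_sqrt_sq_le (n : ℕ) :
    ((Finset.range n).filter fun i => i.sqrt ^ 2 = i).card ≤ n.sqrt + 1 := by
  calc _ ≤ ((Finset.range (n.sqrt + 1)).image (· ^ 2)).card := by
        refine Finset.card_le_card fun i hi => ?_
        rw [Finset.mem_filter, Finset.mem_range] at hi
        rw [Finset.mem_image]
        exact ⟨i.sqrt, Finset.mem_range_succ_iff.2 (Nat.sqrt_le_sqrt hi.1.le), hi.2⟩
    _ ≤ _ := Finset.card_image_le.trans (Finset.card_range _).le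

lemma tendsto_frequency_encodeDigits {w : ℕ → ℕ} (v : ℝ) {j : ℕ} {q : ℝ}
    (h : Tendsto (fun n : ℕ => (∑ i ∈ Finset.range n, if w i = j then (1 : ℝ) else 0) / n) atTop
      (nhds q)) :
    Tendsto (fun n : ℕ => (∑ i ∈ Finset.range n,
      if encodeDigits w v i = j + 1 then (1 : ℝ) else 0) / n) atTop (nhds q) := by
  have hbound : ∀ n : ℕ, |(∑ i ∈ Finset.range n,
      if encodeDigits w v i = j + 1 then (1 : ℝ) else 0) -
      ∑ i ∈ Finset.range n, if w i = j then (1 : ℝ) else 0| ≤ √n + (j + 2) := by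
    intro n
    rw [← Finset.sum_sub_distrib]
    calc _ ≤ ∑ i ∈ Finset.range n, ((if i.sqrt ^ 2 = i then (1 : ℝ) else 0) +
          if i ≤ j then (1 : ℝ) else 0) := by
          refine (Finset.abs_sum_le_sum_abs _ _).trans (Finset.sum_le_sum fun i _ => ?_)
          by_cases hi : i.sqrt ^ 2 = i
          · rw [if_pos hi]
            split_ifs <;> norm_num
          · rw [encodeDigits_of_ne w v hi]
            by_cases hj : i ≤ j
            · simp only [hj, hi, if_true, if_false]
              split_ifs <;> norm_num
            · have : min (w i) i = j ↔ w i = j := by omega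
              simp [this, hi, hj]
      _ ≤ (n.sqrt + 1 : ℕ) + (j + 1 : ℕ) := by
          rw [Finset.sum_add_distrib, Finset.sum_boole, Finset.sum_boole]
          gcongr
          · exact card_filter_sqrt_sq_le n
          · refine (Finset.card_le_card (t := Finset.range (j + 1)) fun i hi => ?_).trans
              (Finset.card_range _).le
            rw [Finset.mem_filter] at hi
            exact Finset.mem_range_succ_iff.2 hi.2
      _ ≤ _ := by
          have := Real.nat_sqrt_le_real_sqrt (a := n)
          push_cast
          linarith
  have hzero : Tendsto (fun n : ℕ => (√n + (j + 2)) / n) atTop (nhds 0) := by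
    have h1 : Tendsto (fun n : ℕ => (√(n : ℝ))⁻¹) atTop (nhds 0) :=
      tendsto_inv_atTop_zero.comp (Real.tendsto_sqrt_atTop.comp tendsto_natCast_atTop_atTop)
    have h2 := tendsto_const_div_atTop_nhds_zero_nat ((j : ℝ) + 2)
    refine (add_zero (0 : ℝ) ▸ h1.add h2).congr fun n => ?_
    rw [add_div _ ((j : ℝ) + 2), Real.sqrt_div_self]
  have hdiff := squeeze_zero_norm (fun n : ℕ => ?_) hzero
    (f := fun n : ℕ => ((∑ i ∈ Finset.range n,
      if encodeDigits w v i = j + 1 then (1 : ℝ) else 0) -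
      ∑ i ∈ Finset.range n, if w i = j then (1 : ℝ) else 0) / n)
  · refine (add_zero q ▸ h.add hdiff).congr fun n => ?_
    ring
  · rw [Real.norm_eq_abs, abs_div, Nat.abs_cast]
    gcongr
    exact hbound n

lemma exists_encoding {p : ℕ → ℝ} (hp : ∀ j, 0 ≤ p j) (hsum : HasSum (fun j => p (j + 1)) 1) :
    ∃ w : ℕ → ℕ, ∀ v y, IsCFOrbit (encodeDigits w v) y → y 0 ∈ Efreq p := by
  obtain ⟨w, hw⟩ := exists_seq_frequency (fun j => p (j + 1)) (fun _ => hp _) hsum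
  refine ⟨w, fun v y hy => ⟨⟨(hy 0).1.le, (hy 0).2.1⟩, hy.irrational, fun j hj => ?_⟩⟩
  obtain ⟨j, rfl⟩ := Nat.exists_eq_add_of_le' hj
  simp_rw [hy.freqCount_eq]
  exact tendsto_frequency_encodeDigits v (hw j)

lemma floor_pow_cubeSum (v : ℝ) (k : ℕ) :
    ⌊(2 : ℝ) ^ cubeSum k * v⌋₊ = ⌊(2 : ℝ) ^ cubeSum (k + 1) * v⌋₊ / 2 ^ (k + 1) ^ 3 := by
  rw [← Nat.floor_div_natCast]
  congr 1
  rw [cubeSum_succ, pow_add]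
  push_cast
  field_simp

lemma exists_first_difference {s t : ℝ} (hs : s ∈ Set.Ico (0 : ℝ) 1) (ht : t ∈ Set.Ico (0 : ℝ) 1)
    (hst : s ≠ t) : ∃ k : ℕ,
      (∀ i ≤ k, ⌊(2 : ℝ) ^ cubeSum i * s⌋₊ = ⌊(2 : ℝ) ^ cubeSum i * t⌋₊) ∧
      ⌊(2 : ℝ) ^ cubeSum (k + 1) * s⌋₊ ≠ ⌊(2 : ℝ) ^ cubeSum (k + 1) * t⌋₊ := by
  classical
  have hex : ∃ k, ⌊(2 : ℝ) ^ cubeSum k * s⌋₊ ≠ ⌊(2 : ℝ) ^ cubeSum k * t⌋₊ := by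
    by_contra! hall
    obtain ⟨k, hk⟩ := pow_unbounded_of_one_lt (1 / |s - t|) one_lt_two
    have hpos : 0 < |s - t| := abs_pos.2 (sub_ne_zero.2 hst)
    rw [div_lt_iff₀ hpos] at hk
    have h1 : (1 : ℝ) < 2 ^ cubeSum k * |s - t| := hk.trans_le <| by
      gcongr
      · norm_num
      · exact le_cubeSum k
    have h2 : |2 ^ cubeSum k * s - 2 ^ cubeSum k * t| < 1 := by
      have e := hall k
      have a1 := Nat.floor_le (mul_nonneg (pow_nonneg zero_le_two (cubeSum k)) hs.1)
      have a2 := Nat.floor_le (mul_nonneg (pow_nonneg zero_le_two (cubeSum k)) ht.1)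
      have a3 := Nat.lt_floor_add_one ((2 : ℝ) ^ cubeSum k * s)
      have a4 := Nat.lt_floor_add_one ((2 : ℝ) ^ cubeSum k * t)
      rw [e] at a1 a3
      rw [abs_lt]
      constructor <;> linarith
    rw [← mul_sub, abs_mul, abs_of_pos (by positivity)] at h2
    linarith
  obtain ⟨k, hk⟩ : ∃ k, Nat.find hex = k + 1 := by
    refine Nat.exists_eq_succ_of_ne_zero fun h0 => ?_
    have := Nat.find_spec hex
    rw [h0] at this
    simp [cubeSum, Nat.floor_eq_zero.2 hs.2, Nat.floor_eq_zero.2 ht.2] at this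
  refine ⟨k, fun i hi => ?_, hk ▸ Nat.find_spec hex⟩
  by_contra h
  have := Nat.find_min' hex h
  omega

/-- The basic comparison between two numbers and the continued fractions encoding them. -/
lemma encoding_separation {w : ℕ → ℕ} {s t : ℝ} {y u : ℕ → ℝ} (hs : s ∈ Set.Ico (0 : ℝ) 1)
    (ht : t ∈ Set.Ico (0 : ℝ) 1) (hst : s ≠ t) (hy : IsCFOrbit (encodeDigits w s) y)
    (hu : IsCFOrbit (encodeDigits w t) u) :
    ∃ (k : ℕ) (d : ℝ), 1 ≤ d ∧ d ≤ 2 ^ k ^ 3 ∧ |s - t| * 2 ^ cubeSum k ≤ 2 * d ∧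
      d ≤ 2 * (|y 0 - u 0| * (2 ^ (cubeSum k + 2 * k ^ 3 + 1)) ^ 2) := by
  obtain ⟨k, hk, hne⟩ := exists_first_difference hs ht hst
  have hdiv : ⌊(2 : ℝ) ^ cubeSum (k + 1) * s⌋₊ / 2 ^ (k + 1) ^ 3 =
      ⌊(2 : ℝ) ^ cubeSum (k + 1) * t⌋₊ / 2 ^ (k + 1) ^ 3 := by
    rw [← floor_pow_cubeSum, ← floor_pow_cubeSum, hk k le_rfl]
  have hA := encodeDigits_sq w s (k + 1)
  have hB := encodeDigits_sq w t (k + 1)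
  have a1 := Nat.floor_le (mul_nonneg (pow_nonneg zero_le_two (cubeSum (k + 1))) hs.1)
  have a2 := Nat.floor_le (mul_nonneg (pow_nonneg zero_le_two (cubeSum (k + 1))) ht.1)
  have a3 := Nat.lt_floor_add_one ((2 : ℝ) ^ cubeSum (k + 1) * s)
  have a4 := Nat.lt_floor_add_one ((2 : ℝ) ^ cubeSum (k + 1) * t)
  have pA := prod_encodeDigits_le w s (k + 1)
  have lA := encodeDigits_sq_add_one_le w s (k + 1)
  have lB := encodeDigits_sq_add_one_le w t (k + 1)
  have mA := Nat.div_add_mod ⌊(2 : ℝ) ^ cubeSum (k + 1) * s⌋₊ (2 ^ (k + 1) ^ 3)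
  have mB := Nat.div_add_mod ⌊(2 : ℝ) ^ cubeSum (k + 1) * t⌋₊ (2 ^ (k + 1) ^ 3)
  rw [hdiv] at mA
  have hlow : ∀ i < (k + 1) ^ 2, encodeDigits w s i = encodeDigits w t i := by
    intro i hi
    rw [encodeDigits, encodeDigits]
    split_ifs with h
    · rw [hk]
      have := Nat.sqrt_lt'.2 hi
      omega
    · rfl
  have hnext : ((k + 1) ^ 2 + 1).sqrt ^ 2 ≠ (k + 1) ^ 2 + 1 :=
    sqrt_sq_ne_of_lt (k := k + 1) (by omega) (by rw [add_sq (k + 1) 1]; omega)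
  have hsep := hy.abs_digit_sub_le hu ((k + 1) ^ 2) hlow (by rw [hA, hB]; omega)
    (by rw [encodeDigits_of_ne w s hnext, encodeDigits_of_ne w t hnext])
    (one_le_encodeDigits w s _)
  generalize encodeDigits w s ((k + 1) ^ 2) = A at *
  generalize encodeDigits w t ((k + 1) ^ 2) = B at *
  generalize ⌊(2 : ℝ) ^ cubeSum (k + 1) * s⌋₊ = F at *
  generalize ⌊(2 : ℝ) ^ cubeSum (k + 1) * t⌋₊ = G at *
  have hFG : (F : ℤ) - G = A - B := by
    rw [hA, hB]
    omega
  have hFG' : (F : ℝ) - G = A - B := by exact_mod_cast hFG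
  have hd : (1 : ℝ) ≤ |(A : ℝ) - B| := by
    have : (1 : ℤ) ≤ |(A : ℤ) - B| := by
      rw [← hFG]
      exact Int.one_le_abs (by omega)
    exact_mod_cast this
  refine ⟨k + 1, |(A : ℝ) - B|, hd, ?_, ?_, ?_⟩
  · have h1 : |(A : ℤ) - B| ≤ 2 ^ (k + 1) ^ 3 := by
      have := Nat.mod_lt F (Nat.two_pow_pos ((k + 1) ^ 3))
      have := Nat.mod_lt G (Nat.two_pow_pos ((k + 1) ^ 3))
      have e : ((2 ^ (k + 1) ^ 3 : ℕ) : ℤ) = 2 ^ (k + 1) ^ 3 := by push_cast; rfl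
      rw [← e, abs_le]
      omega
    exact_mod_cast h1
  · rw [← abs_of_pos (pow_pos (zero_lt_two' ℝ) (cubeSum (k + 1))), ← abs_mul]
    have : |(s - t) * 2 ^ cubeSum (k + 1)| ≤ |(F : ℝ) - G| + 1 := by
      rw [abs_le]
      constructor <;> cases abs_cases ((F : ℝ) - G) <;> nlinarith
    rw [hFG'] at this
    linarith
  · refine hsep.trans ?_
    have pA' : (∏ i ∈ Finset.range ((k + 1) ^ 2), ((encodeDigits w s i : ℝ) + 1)) *
        2 ^ ((k + 1) ^ 3 + 1) ≤ 2 ^ (cubeSum (k + 1) + 2 * (k + 1) ^ 3 + 1) := by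
      exact_mod_cast pA
    have lA' : (A : ℝ) + 1 ≤ 2 ^ ((k + 1) ^ 3 + 1) := by exact_mod_cast lA
    have lB' : (B : ℝ) + 1 ≤ 2 ^ ((k + 1) ^ 3 + 1) := by exact_mod_cast lB
    have hP : 0 ≤ ∏ i ∈ Finset.range ((k + 1) ^ 2), ((encodeDigits w s i : ℝ) + 1) :=
      Finset.prod_nonneg fun i _ => by positivity
    calc _ ≤ 2 * (|y 0 - u 0| *
          (∏ i ∈ Finset.range ((k + 1) ^ 2), ((encodeDigits w s i : ℝ) + 1)) ^ 2 *
          (2 ^ ((k + 1) ^ 3 + 1) * 2 ^ ((k + 1) ^ 3 + 1))) := by gcongr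
      _ = 2 * (|y 0 - u 0| *
          ((∏ i ∈ Finset.range ((k + 1) ^ 2), ((encodeDigits w s i : ℝ) + 1)) *
          2 ^ ((k + 1) ^ 3 + 1)) ^ 2) := by ring
      _ ≤ _ := by gcongr

lemma exponent_bound {ε : ℝ} (hε : 0 < ε) (k : ℕ) :
    3 + 3 * (k : ℝ) ^ 3 - ε * cubeSum k ≤ 3 + 3 * (12 / ε) ^ 3 := by
  have h1 : (k : ℝ) ^ 4 ≤ 4 * cubeSum k := by exact_mod_cast pow_four_le_cubeSum k
  have h2 : (0 : ℝ) ≤ cubeSum k := Nat.cast_nonneg _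
  rcases le_total (k : ℝ) (12 / ε) with h | h
  · have : (k : ℝ) ^ 3 ≤ (12 / ε) ^ 3 := by gcongr
    nlinarith [mul_nonneg hε.le h2]
  · have h3 : 12 ≤ ε * k := by rwa [div_le_iff₀' hε] at h
    have h4 : (0 : ℝ) ≤ (k : ℝ) ^ 3 := by positivity
    have h5 : 0 ≤ (12 / ε) ^ 3 := by positivity
    nlinarith [mul_le_mul_of_nonneg_right h3 h4, mul_le_mul_of_nonneg_left h1 hε.le]

lemma holder_of_separation {s : ℝ} (hs : 0 < s) (hs' : s < 1 / 2) {k : ℕ} {d δ Δ : ℝ} (hΔ : 0 ≤ Δ)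
    (hd : 1 ≤ d) (hdk : d ≤ 2 ^ k ^ 3) (hδ : δ * 2 ^ cubeSum k ≤ 2 * d)
    (hdΔ : d ≤ 2 * (Δ * (2 ^ (cubeSum k + 2 * k ^ 3 + 1)) ^ 2)) :
    δ ≤ 2 ^ (3 + 3 * (12 / (1 - 2 * s)) ^ 3) * Δ ^ s := by
  have hd0 : 0 < d := by linarith
  have h2 : (0 : ℝ) < 2 := two_pos
  have e1 : d ^ s ≤ 2 ^ (s * (2 * cubeSum k + 4 * k ^ 3 + 3)) * Δ ^ s := by
    have e : 2 * (Δ * (2 ^ (cubeSum k + 2 * k ^ 3 + 1)) ^ 2) =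
        (2 : ℝ) ^ (2 * (cubeSum k : ℝ) + 4 * k ^ 3 + 3) * Δ := by
      rw [show (2 * (cubeSum k : ℝ) + 4 * k ^ 3 + 3) =
        ((2 * cubeSum k + 4 * k ^ 3 + 3 : ℕ) : ℝ) by push_cast; ring, Real.rpow_natCast]
      ring
    rw [e] at hdΔ
    calc d ^ s ≤ _ := Real.rpow_le_rpow hd0.le hdΔ hs.le
      _ = _ := by rw [Real.mul_rpow (by positivity) hΔ, ← Real.rpow_mul h2.le, mul_comm s]
  have e2 : d ≤ d ^ s * 2 ^ ((k : ℝ) ^ 3) := by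
    calc d = d ^ s * d ^ (1 - s) := by
          rw [← Real.rpow_add hd0, add_sub_cancel, Real.rpow_one]
      _ ≤ d ^ s * d ^ (1 : ℝ) := by
          gcongr
          linarith
      _ ≤ d ^ s * 2 ^ ((k : ℝ) ^ 3) := by
          gcongr
          rw [Real.rpow_one]
          exact_mod_cast hdk
  have e3 : δ ≤ 2 * d * 2 ^ (-(cubeSum k : ℝ)) := by
    rw [Real.rpow_neg h2.le, Real.rpow_natCast, ← div_eq_mul_inv, le_div_iff₀ (by positivity)]
    exact hδ
  calc δ ≤ 2 * d * 2 ^ (-(cubeSum k : ℝ)) := e3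
    _ ≤ 2 * ((2 ^ (s * (2 * cubeSum k + 4 * k ^ 3 + 3)) * Δ ^ s) * 2 ^ ((k : ℝ) ^ 3)) *
        2 ^ (-(cubeSum k : ℝ)) := by
        gcongr
        exact e2.trans (by gcongr)
    _ = 2 ^ (1 + s * (2 * cubeSum k + 4 * k ^ 3 + 3) + (k : ℝ) ^ 3 + -(cubeSum k : ℝ)) * Δ ^ s := by
        rw [Real.rpow_add h2, Real.rpow_add h2, Real.rpow_add h2, Real.rpow_one]
        ring
    _ ≤ _ := by
        refine mul_le_mul_of_nonneg_right (Real.rpow_le_rpow_of_exponent_le one_le_two ?_)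
          (Real.rpow_nonneg hΔ s)
        · refine le_trans ?_ (exponent_bound (ε := 1 - 2 * s) (by linarith) k)
          have : (0 : ℝ) ≤ (k : ℝ) ^ 3 := by positivity
          nlinarith

/-- For every frequency vector `p`, `dim_H(E_p) ≥ 1/2`. -/
theorem stmt17 (p : ℕ → ℝ) (hp : ∀ j, 0 ≤ p j) (hsum : HasSum (fun j => p (j + 1)) 1) :
    (1 / 2 : ENNReal) ≤ dimH (Efreq p) := by
  obtain ⟨w, hw⟩ := exists_encoding hp hsum
  choose Y hY using fun v => exists_isCFOrbit (encodeDigits w v) (one_le_encodeDigits w v)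
  refine le_of_forall_lt fun r hr => ?_
  obtain ⟨s, hrs, hs⟩ := ENNReal.lt_iff_exists_nnreal_btwn.1 hr
  refine hrs.trans_le ?_
  have hs0 : (0 : ℝ) < s := by exact_mod_cast (zero_le.trans_lt hrs)
  have hs1 : (s : ℝ) < 1 / 2 := by
    have := (ENNReal.toReal_lt_toReal (by simp) (by simp)).2 hs
    simpa using this
  have hholder : ∀ v ∈ Set.Ico (0 : ℝ) 1, ∀ v' ∈ Set.Ico (0 : ℝ) 1,
      |v - v'| ≤ 2 ^ (3 + 3 * (12 / (1 - 2 * (s : ℝ))) ^ 3) * |Y v 0 - Y v' 0| ^ (s : ℝ) := by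
    intro v hv v' hv'
    rcases eq_or_ne v v' with rfl | hne
    · simp [hs0.ne']
    · obtain ⟨k, d, h1, h2, h3, h4⟩ := encoding_separation hv hv' hne (hY v) (hY v')
      exact holder_of_separation hs0 hs1 (abs_nonneg _) h1 h2 h3 h4
  have hinj : Set.InjOn (fun v => Y v 0) (Set.Ico 0 1) := fun v hv v' hv' he => by
    have := hholder v hv v' hv'
    simp only at he
    rw [he, sub_self, abs_zero, Real.zero_rpow hs0.ne', mul_zero] at this
    exact sub_eq_zero.1 (abs_nonpos_iff.1 this)
  have hinv := hinj.leftInvOn_invFunOn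
  have hHolder : HolderOnWith (2 ^ (3 + 3 * (12 / (1 - 2 * (s : ℝ))) ^ 3)) s
      (Function.invFunOn (fun v => Y v 0) (Set.Ico 0 1)) ((fun v => Y v 0) '' Set.Ico 0 1) := by
    rintro _ ⟨v, hv, rfl⟩ _ ⟨v', hv', rfl⟩
    rw [hinv hv, hinv hv', edist_dist, edist_dist, Real.dist_eq, Real.dist_eq,
      ENNReal.ofReal_rpow_of_nonneg (abs_nonneg _) hs0.le]
    refine (ENNReal.ofReal_le_ofReal (hholder v hv v' hv')).trans_eq ?_
    rw [ENNReal.ofReal_mul (by positivity)]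
    congr 1
    rw [← ENNReal.ofReal_coe_nnreal]
    simp
  have hdim := hHolder.dimH_image_le (by exact_mod_cast hs0)
  rw [hinv.image_image, Real.dimH_of_nonempty_interior (by simp), Module.finrank_self,
    Nat.cast_one, ENNReal.le_div_iff_mul_le (by simp [NNReal.coe_pos.1 hs0 |>.ne']) (by simp),
    one_mul] at hdim
  refine hdim.trans (dimH_mono ?_)
  rintro _ ⟨v, _, rfl⟩
  exact hw v _ (hY v)
end

section
/- Let p⃗ = (p_1, p_2, ...) be a frequency vector. There exists a Borel probability measure μ on [0,1) that is invariant and ergodic for the Gauss map T, satisfies ∫_0^1 |log x| dμ(x) < ∞, and satisfies μ(I(j)) = p_j for all j ≥ 1, if and only if ∑_{j=1}^∞ p_j log j < ∞. -/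
open MeasureTheory

/-- The rank-1 basic interval `I(j) = (1/(j+1), 1/j] ∩ [0,1)`, the set of points whose first
partial quotient is `j`. -/
def Ibasic (j : ℕ) : Set ℝ := Set.Ioc (1 / ((j : ℝ) + 1)) (1 / (j : ℝ)) ∩ Set.Ico 0 1

open Filter Topology ProbabilityTheory Function

theorem measurable_gaussMap : Measurable gaussMap :=
  Measurable.ite (measurableSet_singleton 0) measurable_const
    (measurable_fract.comp (measurable_const.div measurable_id))

/-! ### The one-sided full shift -/

/-- The one-sided shift on sequences. -/
def seqShift {α : Type*} (a : ℕ → α) : ℕ → α := fun i => a (i + 1)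

theorem seqShift_iterate_apply {α : Type*} (n i : ℕ) (a : ℕ → α) :
    seqShift^[n] a i = a (i + n) := by
  induction n generalizing a with
  | zero => rfl
  | succ n ih => rw [iterate_succ_apply, ih]; simp [seqShift, Nat.add_assoc]

theorem measurable_seqShift {α : Type*} [MeasurableSpace α] :
    Measurable (seqShift : (ℕ → α) → ℕ → α) :=
  measurable_pi_lambda _ fun i => measurable_pi_apply (i + 1)

/-- Bernoulli measures are ergodic for the one-sided shift. -/
theorem ergodic_seqShift_infinitePi {α : Type*} [MeasurableSpace α] (ν : Measure α)
    [IsProbabilityMeasure ν] :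
    Ergodic seqShift (Measure.infinitePi fun _ : ℕ => ν) where
  measurable := measurable_seqShift
  map_eq := Measure.map_infinitePi_infinitePi_of_inj (P := fun _ : ℕ => ν)
    (f := fun i : ℕ => i + 1) (add_left_injective 1)
  aeconst_set s hs hinv := by
    have hind : iIndepFun (fun (i : ℕ) (a : ℕ → α) => a i) (Measure.infinitePi fun _ : ℕ => ν) :=
      iIndepFun_infinitePi (P := fun _ : ℕ => ν) (X := fun _ x => x) fun _ => measurable_id
    have htail : MeasurableSet[limsup (fun i : ℕ =>
        MeasurableSpace.comap (fun a : ℕ → α => a i) inferInstance) atTop] s := by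
      rw [limsup_eq_iInf_iSup_of_nat, MeasurableSpace.measurableSet_iInf]
      intro n
      have hn : seqShift^[n] ⁻¹' s = s := IsFixedPt.preimage_iterate hinv n
      rw [← hn]
      have hmeas : Measurable[⨆ i, ⨆ (_ : i ≥ n),
          MeasurableSpace.comap (fun a : ℕ → α => a i) inferInstance] (seqShift^[n]) := by
        refine @measurable_pi_lambda _ _ _ (_) _ _ fun i => ?_
        simp only [seqShift_iterate_apply]
        rw [measurable_iff_comap_le]
        exact le_iSup₂_of_le (i + n) (Nat.le_add_left n i) le_rfl
      exact hmeas hs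
    have h01 := measure_zero_or_one_of_measurableSet_limsup_atTop
      (fun i => (measurable_pi_apply i).comap_le) hind.iIndep htail
    rw [eventuallyConst_set']
    rcases h01 with h | h
    · exact Or.inl (ae_eq_empty.2 h)
    · exact Or.inr (ae_eq_univ.2 ((prob_compl_eq_zero_iff hs).2 h))

/-! ### Continued fraction expansions -/

/-- The `n`-th convergent of the continued fraction `[0; a₀ + 1, a₁ + 1, …]`. -/
noncomputable def cfApprox : ℕ → (ℕ → ℕ) → ℝ
  | 0, _ => 0
  | n + 1, a => 1 / ((a 0 : ℝ) + 1 + cfApprox n (seqShift a))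

/-- The value of the continued fraction `[0; a₀ + 1, a₁ + 1, …]`. -/
noncomputable def cfValue (a : ℕ → ℕ) : ℝ := limUnder atTop fun n => cfApprox n a

theorem cfApprox_mem_Icc (n : ℕ) (a : ℕ → ℕ) : cfApprox n a ∈ Set.Icc (0 : ℝ) 1 := by
  induction n generalizing a with
  | zero => simp [cfApprox]
  | succ n ih =>
    have h := (ih (seqShift a)).1
    have ha : (0 : ℝ) ≤ a 0 := Nat.cast_nonneg _
    rw [cfApprox]
    exact ⟨by positivity, (div_le_one (by positivity)).2 (by linarith)⟩

theorem abs_inv_add_inv_add_sub_le {c d x y : ℝ} (hc : 1 ≤ c) (hd : 1 ≤ d) (hx : 0 ≤ x)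
    (hy : 0 ≤ y) :
    |1 / (c + 1 / (d + x)) - 1 / (c + 1 / (d + y))| ≤ 1 / 4 * |x - y| := by
  have hX : 2 ≤ c * (d + x) + 1 := by nlinarith
  have hY : 2 ≤ c * (d + y) + 1 := by nlinarith
  have hdx : 0 < d + x := by linarith
  have hdy : 0 < d + y := by linarith
  have hc0 : 0 < c := by linarith
  have key : 1 / (c + 1 / (d + x)) - 1 / (c + 1 / (d + y))
      = (x - y) / ((c * (d + x) + 1) * (c * (d + y) + 1)) := by
    field_simp
    ring
  have hprod : 4 ≤ (c * (d + x) + 1) * (c * (d + y) + 1) := by nlinarith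
  rw [key, abs_div, abs_of_pos (show 0 < (c * (d + x) + 1) * (c * (d + y) + 1) by linarith),
    div_le_iff₀ (by linarith)]
  nlinarith [abs_nonneg (x - y)]

theorem abs_cfApprox_sub_succ_le (n : ℕ) (a : ℕ → ℕ) :
    |cfApprox n a - cfApprox (n + 1) a| ≤ 2 * (1 / 2) ^ n := by
  induction n using Nat.twoStepInduction generalizing a with
  | zero =>
    have h0 := cfApprox_mem_Icc 0 a
    have h1 := cfApprox_mem_Icc 1 a
    rw [abs_le]
    constructor <;> norm_num <;> linarith [h0.1, h0.2, h1.1, h1.2]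
  | one =>
    have h0 := cfApprox_mem_Icc 1 a
    have h1 := cfApprox_mem_Icc 2 a
    rw [abs_le]
    constructor <;> norm_num <;> linarith [h0.1, h0.2, h1.1, h1.2]
  | more n ih _ =>
    have h := ih (seqShift (seqShift a))
    have hstep := abs_inv_add_inv_add_sub_le (c := (a 0 : ℝ) + 1) (d := ((seqShift a 0 : ℕ) : ℝ) + 1)
      (by simp) (by simp) (cfApprox_mem_Icc n (seqShift (seqShift a))).1
      (cfApprox_mem_Icc (n + 1) (seqShift (seqShift a))).1
    calc |cfApprox (n + 2) a - cfApprox (n + 2 + 1) a|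
        ≤ 1 / 4 * |cfApprox n (seqShift (seqShift a))
            - cfApprox (n + 1) (seqShift (seqShift a))| := hstep
      _ ≤ 1 / 4 * (2 * (1 / 2) ^ n) := by gcongr
      _ = 2 * (1 / 2) ^ (n + 2) := by ring

theorem tendsto_cfApprox (a : ℕ → ℕ) :
    Tendsto (fun n => cfApprox n a) atTop (𝓝 (cfValue a)) :=
  (cauchySeq_of_le_geometric (1 / 2) 2 (by norm_num) fun n => by
    rw [Real.dist_eq]; exact abs_cfApprox_sub_succ_le n a).tendsto_limUnder

theorem measurable_cfApprox (n : ℕ) : Measurable (cfApprox n) := by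
  induction n with
  | zero => exact measurable_const
  | succ n ih =>
    have h0 : Measurable fun a : ℕ → ℕ => (a 0 : ℝ) :=
      measurable_from_top.comp (measurable_pi_apply 0)
    exact measurable_const.div ((h0.add_const 1).add (ih.comp measurable_seqShift))

theorem measurable_cfValue : Measurable cfValue :=
  measurable_of_tendsto_metrizable measurable_cfApprox
    (tendsto_pi_nhds.2 tendsto_cfApprox)

theorem cfValue_mem_Icc (a : ℕ → ℕ) : cfValue a ∈ Set.Icc (0 : ℝ) 1 :=
  isClosed_Icc.mem_of_tendsto (tendsto_cfApprox a) (Eventually.of_forall fun n =>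
    cfApprox_mem_Icc n a)

theorem cfValue_eq (a : ℕ → ℕ) : cfValue a = 1 / ((a 0 : ℝ) + 1 + cfValue (seqShift a)) := by
  have hpos : (a 0 : ℝ) + 1 + cfValue (seqShift a) ≠ 0 := by
    have := (cfValue_mem_Icc (seqShift a)).1
    positivity
  refine tendsto_nhds_unique ((tendsto_cfApprox a).comp (tendsto_add_atTop_nat 1)) ?_
  exact (tendsto_const_nhds.div ((tendsto_cfApprox (seqShift a)).const_add _) hpos)

theorem cfValue_pos (a : ℕ → ℕ) : 0 < cfValue a := by
  have := (cfValue_mem_Icc (seqShift a)).1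
  rw [cfValue_eq]
  positivity

theorem cfValue_lt_inv (a : ℕ → ℕ) : cfValue a < 1 / ((a 0 : ℝ) + 1) := by
  have := cfValue_pos (seqShift a)
  rw [cfValue_eq]
  exact one_div_lt_one_div_of_lt (by positivity) (by linarith)

theorem cfValue_lt_one (a : ℕ → ℕ) : cfValue a < 1 :=
  (cfValue_lt_inv a).trans_le ((div_le_one (by positivity)).2 (by simp))

theorem inv_lt_cfValue (a : ℕ → ℕ) : 1 / ((a 0 : ℝ) + 2) < cfValue a := by
  have h0 := cfValue_pos (seqShift a)
  have h1 := cfValue_lt_one (seqShift a)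
  rw [cfValue_eq]
  exact one_div_lt_one_div_of_lt (by positivity) (by linarith)

theorem semiconj_cfValue : Semiconj cfValue seqShift gaussMap := by
  intro a
  have h : 1 / cfValue a = (a 0 : ℝ) + 1 + cfValue (seqShift a) := by
    rw [cfValue_eq a, one_div_one_div]
  rw [gaussMap, if_neg (cfValue_pos a).ne', h,
    show (a 0 : ℝ) + 1 = ((a 0 + 1 : ℕ) : ℝ) by push_cast; rfl, Int.fract_natCast_add]
  exact (Int.fract_eq_self.2 ⟨(cfValue_pos _).le, cfValue_lt_one _⟩).symm

theorem pairwise_disjoint_Ibasic_succ : Pairwise (Disjoint on fun j : ℕ => Ibasic (j + 1)) := by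
  refine (pairwise_disjoint_on _).2 fun i j hij => Set.disjoint_left.2 ?_
  rintro x ⟨hi, -⟩ ⟨hj, -⟩
  have hle : 1 / ((j + 1 : ℕ) : ℝ) ≤ 1 / (((i + 1 : ℕ) : ℝ) + 1) := by
    refine one_div_le_one_div_of_le (by positivity) ?_
    exact_mod_cast Nat.succ_le_succ hij
  exact absurd (hi.1.trans_le (hj.2.trans hle)) (lt_irrefl _)

theorem cfValue_mem_Ibasic (a : ℕ → ℕ) : cfValue a ∈ Ibasic (a 0 + 1) := by
  refine ⟨⟨?_, ?_⟩, (cfValue_pos a).le, cfValue_lt_one a⟩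
  · rw [show ((a 0 + 1 : ℕ) : ℝ) + 1 = (a 0 : ℝ) + 2 by push_cast; ring]
    exact inv_lt_cfValue a
  · push_cast
    exact (cfValue_lt_inv a).le

theorem cfValue_preimage_Ibasic_succ (j : ℕ) :
    cfValue ⁻¹' Ibasic (j + 1) = (fun a : ℕ → ℕ => a 0) ⁻¹' {j} := by
  ext a
  constructor
  · intro h
    by_contra hne
    exact Set.disjoint_left.1 (pairwise_disjoint_Ibasic_succ hne) (cfValue_mem_Ibasic a) h
  · rintro rfl
    exact cfValue_mem_Ibasic a

theorem abs_log_cfValue_le (a : ℕ → ℕ) : |Real.log (cfValue a)| ≤ Real.log ((a 0 : ℝ) + 2) := by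
  rw [abs_of_nonpos (Real.log_nonpos (cfValue_pos a).le (cfValue_lt_one a).le), ← Real.log_inv]
  refine Real.log_le_log (inv_pos.2 (cfValue_pos a)) ?_
  rw [inv_le_comm₀ (cfValue_pos a) (by positivity), ← one_div]
  exact (inv_lt_cfValue a).le

theorem measurableSet_Ibasic (j : ℕ) : MeasurableSet (Ibasic j) :=
  measurableSet_Ioc.inter measurableSet_Ico

theorem log_le_abs_log_of_mem_Ibasic {j : ℕ} (hj : 1 ≤ j) {x : ℝ} (hx : x ∈ Ibasic j) :
    Real.log j ≤ |Real.log x| := by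
  have hj0 : (0 : ℝ) < j := by exact_mod_cast hj
  have hx0 : 0 < x := lt_trans (by positivity) hx.1.1
  refine le_trans ?_ (neg_le_abs _)
  rw [← Real.log_inv]
  refine Real.log_le_log hj0 ?_
  rw [le_inv_comm₀ hj0 hx0, ← one_div]
  exact hx.1.2

/-- For a frequency vector `p`, there exists a Borel probability measure `μ` on `[0,1)` which
is invariant and ergodic for the Gauss map, satisfies `∫ |log x| dμ < ∞` and `μ(I(j)) = p_j`
for all `j ≥ 1`, if and only if `∑_{j≥1} p_j log j < ∞`. -/
theorem stmt19 (p : ℕ → ℝ) (hp : ∀ j, 0 ≤ p j) (hsum : HasSum (fun j => p (j + 1)) 1) :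
    (∃ μ : Measure ℝ, IsProbabilityMeasure μ ∧ μ (Set.Ico (0 : ℝ) 1) = 1 ∧
        Ergodic gaussMap μ ∧ (∫⁻ x, ENNReal.ofReal |Real.log x| ∂μ) < ⊤ ∧
        ∀ j, 1 ≤ j → μ (Ibasic j) = ENNReal.ofReal (p j)) ↔
      Summable (fun j : ℕ => p (j + 1) * Real.log ((j : ℝ) + 1)) := by
  have hlog (j : ℕ) : 0 ≤ Real.log ((j : ℝ) + 1) := Real.log_nonneg (by simp)
  constructor
  · rintro ⟨μ, -, -, -, hlogint, hI⟩
    have hterm (j : ℕ) : ENNReal.ofReal (p (j + 1) * Real.log ((j : ℝ) + 1))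
        ≤ ∫⁻ x in Ibasic (j + 1), ENNReal.ofReal |Real.log x| ∂μ := by
      rw [ENNReal.ofReal_mul (hp _), ← hI (j + 1) (by simp), mul_comm, ← setLIntegral_const]
      refine setLIntegral_mono' (measurableSet_Ibasic _) fun x hx => ENNReal.ofReal_le_ofReal ?_
      simpa using log_le_abs_log_of_mem_Ibasic (by simp) hx
    have hle : ∑' j : ℕ, ENNReal.ofReal (p (j + 1) * Real.log ((j : ℝ) + 1))
        ≤ ∫⁻ x, ENNReal.ofReal |Real.log x| ∂μ := by
      refine (ENNReal.tsum_le_tsum hterm).trans ?_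
      rw [← lintegral_iUnion (fun j => measurableSet_Ibasic (j + 1))
        pairwise_disjoint_Ibasic_succ]
      exact setLIntegral_le_lintegral _ _
    refine (ENNReal.summable_toReal (hle.trans_lt hlogint).ne).congr fun j => ?_
    exact ENNReal.toReal_ofReal (mul_nonneg (hp _) (hlog j))
  · intro hsummable
    have hpmf : HasSum (fun j : ℕ => ENNReal.ofReal (p (j + 1))) 1 := by
      have h := ENNReal.ofReal_tsum_of_nonneg (fun j => hp (j + 1)) hsum.summable
      rw [hsum.tsum_eq, ENNReal.ofReal_one] at h
      exact h ▸ ENNReal.summable.hasSum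
    let ν : Measure ℕ := PMF.toMeasure ⟨fun j => ENNReal.ofReal (p (j + 1)), hpmf⟩
    have hν (j : ℕ) : ν {j} = ENNReal.ofReal (p (j + 1)) :=
      PMF.toMeasure_apply_singleton _ _ (measurableSet_singleton _)
    have : IsProbabilityMeasure ν := PMF.toMeasure.isProbabilityMeasure _
    let P : Measure (ℕ → ℕ) := Measure.infinitePi fun _ => ν
    have hcoord : MeasurePreserving (fun a : ℕ → ℕ => a 0) P ν :=
      measurePreserving_eval_infinitePi (fun _ : ℕ => ν) 0
    have hfactor : MeasurePreserving cfValue P (P.map cfValue) :=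
      measurable_cfValue.measurePreserving P
    refine ⟨P.map cfValue, Measure.isProbabilityMeasure_map measurable_cfValue.aemeasurable,
      ?_, ?_, ?_, ?_⟩
    · rw [Measure.map_apply measurable_cfValue measurableSet_Ico]
      have huniv : cfValue ⁻¹' Set.Ico (0 : ℝ) 1 = Set.univ :=
        Set.eq_univ_of_forall fun a => ⟨(cfValue_pos a).le, cfValue_lt_one a⟩
      rw [huniv, measure_univ]
    · exact hfactor.ergodic_of_ergodic_semiconj (ergodic_seqShift_infinitePi ν)
        measurable_gaussMap semiconj_cfValue
    · have hbound (j : ℕ) : Real.log ((j : ℝ) + 2) ≤ Real.log 2 + Real.log ((j : ℝ) + 1) := by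
        rw [← Real.log_mul (by norm_num) (by positivity)]
        exact Real.log_le_log (by positivity) (by linarith [Nat.cast_nonneg (α := ℝ) j])
      have hsummable' : Summable fun j : ℕ => Real.log ((j : ℝ) + 2) * p (j + 1) := by
        refine Summable.of_nonneg_of_le
          (fun j => mul_nonneg (Real.log_nonneg (by linarith [Nat.cast_nonneg (α := ℝ) j])) (hp _))
          (fun j => mul_le_mul_of_nonneg_right (hbound j) (hp _)) ?_
        refine ((hsum.summable.mul_left (Real.log 2)).add hsummable).congr fun j => ?_
        ring
      calc ∫⁻ x, ENNReal.ofReal |Real.log x| ∂(P.map cfValue)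
          = ∫⁻ a, ENNReal.ofReal |Real.log (cfValue a)| ∂P :=
            lintegral_map (by fun_prop) measurable_cfValue
        _ ≤ ∫⁻ a, ENNReal.ofReal (Real.log ((a 0 : ℝ) + 2)) ∂P :=
            lintegral_mono fun a => ENNReal.ofReal_le_ofReal (abs_log_cfValue_le a)
        _ = ∫⁻ j : ℕ, ENNReal.ofReal (Real.log ((j : ℝ) + 2)) ∂ν :=
            hcoord.lintegral_comp (f := fun j : ℕ => ENNReal.ofReal (Real.log ((j : ℝ) + 2)))
              measurable_from_top
        _ = ∑' j : ℕ, ENNReal.ofReal (Real.log ((j : ℝ) + 2) * p (j + 1)) := by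
            rw [lintegral_countable']
            refine tsum_congr fun j => ?_
            rw [hν, ENNReal.ofReal_mul (Real.log_nonneg
              (by linarith [Nat.cast_nonneg (α := ℝ) j]))]
        _ < ⊤ := hsummable'.tsum_ofReal_lt_top
    · intro j hj
      obtain ⟨k, rfl⟩ := Nat.exists_eq_add_of_le' hj
      rw [Measure.map_apply measurable_cfValue (measurableSet_Ibasic _),
        cfValue_preimage_Ibasic_succ,
        hcoord.measure_preimage (measurableSet_singleton k).nullMeasurableSet, hν]
end
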